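/- Let φ be an EFD-system in the hoop language 𝓛_H such that the positive cone of some nontrivial abelian ℓ-group satisfies φ. Then there exists a positive integer k such that for every abelian ℓ-group G: the positive cone G⁺ satisfies φ if and only if for every x ∈ G⁺ there is exactly one z ∈ G⁺ with k • z = x. (Every EFD-sentence with a nontrivial model among cancellative hoops is equivalent over cancellative hoops to δ_k for some k.) -/

import Mathlib

open FirstOrder Language

/-- The binary function symbols of the hoop language: `+` and truncated subtraction `∸`. -/
inductive HoopBin : Type
  | add : HoopBin
  | tsub : HoopBin

/-- Function symbols of the hoop language: a constant `0` and binary `+`, `∸`. -/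
def HoopFunc : ℕ → Type
  | 0 => Unit
  | 1 => Empty
  | 2 => HoopBin
  | _ => Empty

/-- The first-order language of hoops (cancellative hoops). -/
def HoopLang : FirstOrder.Language :=
  ⟨HoopFunc, fun _ => Empty⟩

/-- The hoop structure on the positive cone `G⁺ = {x : G // 0 ≤ x}` of an abelian
ℓ-group `G`: addition `a + b`, truncated subtraction `a ∸ b = (a - b) ⊔ 0`, and `0`. -/
instance hoopStructurePosCone (G : Type*) [Lattice G] [AddCommGroup G]
    [CovariantClass G G (· + ·) (· ≤ ·)] :
    HoopLang.Structure {x : G // 0 ≤ x} where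
  funMap {n} f x :=
    match n, f, x with
    | 0, _, _ => ⟨0, le_refl 0⟩
    | 1, f, _ => f.elim
    | 2, HoopBin.add, x =>
        ⟨(x 0 : G) + (x 1 : G), le_trans (x 0).2 (le_add_of_nonneg_right (x 1).2)⟩
    | 2, HoopBin.tsub, x => ⟨((x 0 : G) - (x 1 : G)) ⊔ 0, le_sup_right⟩
    | (_+3), f, _ => f.elim
  RelMap {_} r := r.elim

/-- An EFD-system in a language `L`: data for an EFD-sentence
`∀ x_1 … x_n ∃! z_1 … z_m, ⋀_{i<r} s_i(x̄,z̄) = t_i(x̄,z̄)` with `m, r ≥ 1`. -/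
structure EFDSystem (L : FirstOrder.Language) where
  n : ℕ
  m : ℕ
  r : ℕ
  hm : 0 < m
  hr : 0 < r
  lhs : Fin r → L.Term (Fin n ⊕ Fin m)
  rhs : Fin r → L.Term (Fin n ⊕ Fin m)

/-- A structure `G` satisfies an EFD-system if for every tuple `x` there is exactly one
tuple `z` solving all the equations. -/
def EFDSystem.Satisfies {L : FirstOrder.Language} (φ : EFDSystem L)
    (G : Type*) [L.Structure G] : Prop :=
  ∀ x : Fin φ.n → G, ∃! z : Fin φ.m → G, ∀ i : Fin φ.r,
    Term.realize (Sum.elim x z) (φ.lhs i) = Term.realize (Sum.elim x z) (φ.rhs i)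

theorem nsmul_inf_nsmul_eq_zero {G : Type*} [Lattice G] [AddCommGroup G] [AddLeftMono G] {a b : G}
    (h : a ⊓ b = 0) (n : ℕ) : (n • a) ⊓ (n • b) = 0 := by
  have ha : 0 ≤ a := h ▸ inf_le_left
  have hb : 0 ≤ b := h ▸ inf_le_right
  have key : ∀ {c d : G}, 0 ≤ c → 0 ≤ d → c ⊓ d = 0 → ∀ n : ℕ, (n • c) ⊓ d = 0 := by
    intro c d hc hd hcd n
    induction n with
    | zero => simpa using hd
    | succ n ih =>
      apply le_antisymm _ (le_inf (nsmul_nonneg hc _) hd)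
      rw [← ih]
      refine le_inf ?_ inf_le_right
      have h1 : ((n + 1) • c) ⊓ d ≤ (n • c + c) ⊓ (n • c + d) := by
        rw [succ_nsmul]
        exact inf_le_inf le_rfl (le_add_of_nonneg_left (nsmul_nonneg hc n))
      rwa [← add_inf, hcd, add_zero] at h1
  have h1 := key ha hb h n
  rw [inf_comm] at h1 ⊢
  exact key hb (nsmul_nonneg ha n) h1 n

/-- The subgroup contains every element dominated in absolute value by one of its members. -/
def IsSolidSubgroup {G : Type*} [Lattice G] [AddCommGroup G] (P : AddSubgroup G) : Prop :=
  ∀ x, ∀ y ∈ P, |x| ≤ |y| → x ∈ P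

/-- A solid subgroup which is maximal among those avoiding `g` is prime. -/
theorem exists_prime_solid_addSubgroup {G : Type*} [Lattice G] [AddCommGroup G] [AddLeftMono G]
    {g : G} (hg : g ≠ 0) : ∃ P : AddSubgroup G, IsSolidSubgroup P ∧ g ∉ P ∧
      ∀ a b, a ⊓ b = 0 → a ∈ P ∨ b ∈ P := by
  obtain ⟨P, -, hP⟩ := zorn_le_nonempty₀ {P : AddSubgroup G | IsSolidSubgroup P ∧ g ∉ P} (by
    intro c hc hch Q hQ
    have hmem : ∀ x, x ∈ sSup c ↔ ∃ P ∈ c, x ∈ P := fun x =>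
      AddSubgroup.mem_sSup_of_directedOn ⟨Q, hQ⟩ hch.directedOn
    refine ⟨sSup c, ⟨?_, ?_⟩, fun z hz => le_sSup hz⟩
    · intro x y hy hxy
      obtain ⟨P, hPc, hyP⟩ := (hmem y).1 hy
      exact (hmem x).2 ⟨P, hPc, (hc hPc).1 x y hyP hxy⟩
    · intro h
      obtain ⟨P, hPc, hgP⟩ := (hmem g).1 h
      exact (hc hPc).2 hgP) ⊥ ⟨fun x y hy hxy => by
        rw [AddSubgroup.mem_bot] at hy ⊢
        subst hy
        exact le_antisymm ((le_abs_self x).trans (by simpa using hxy))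
          (neg_nonpos.1 ((neg_le_abs x).trans (by simpa using hxy))), by simpa using hg⟩
  refine ⟨P, hP.prop.1, hP.prop.2, fun a b hab => ?_⟩
  by_contra! hcon
  have ha : 0 ≤ a := hab ▸ inf_le_left
  have hb : 0 ≤ b := hab ▸ inf_le_right
  have key : ∀ c, 0 ≤ c → c ∉ P → ∃ p ∈ P, 0 ≤ p ∧ ∃ n : ℕ, |g| ≤ p + n • c := by
    intro c hc hcP
    by_contra! hcon
    let Q : AddSubgroup G :=
      { carrier := {x | ∃ p ∈ P, 0 ≤ p ∧ ∃ n : ℕ, |x| ≤ p + n • c}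
        zero_mem' := ⟨0, P.zero_mem, le_rfl, 0, by simp⟩
        add_mem' := by
          rintro x y ⟨p, hp, hp0, n, hn⟩ ⟨q, hq, hq0, k, hk⟩
          refine ⟨p + q, P.add_mem hp hq, add_nonneg hp0 hq0, n + k, ?_⟩
          calc |x + y| ≤ |x| + |y| := abs_add_le x y
            _ ≤ (p + n • c) + (q + k • c) := add_le_add hn hk
            _ = _ := by rw [add_nsmul]; abel
        neg_mem' := by
          rintro x ⟨p, hp, hp0, n, hn⟩
          exact ⟨p, hp, hp0, n, by rwa [abs_neg]⟩ }
    have hQ : Q ∈ {P : AddSubgroup G | IsSolidSubgroup P ∧ g ∉ P} := by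
      refine ⟨?_, ?_⟩
      · rintro x y ⟨p, hp, hp0, n, hn⟩ hxy
        exact ⟨p, hp, hp0, n, hxy.trans hn⟩
      · rintro ⟨p, hp, hp0, n, hn⟩
        exact hcon p hp hp0 n hn
    have hle : P ≤ Q := fun x hx => ⟨|x|, hP.prop.1 _ x hx (by rw [abs_abs]), abs_nonneg x, 0, by simp⟩
    have : Q ≤ P := hP.2 hQ hle
    exact hcP (this ⟨0, P.zero_mem, le_rfl, 1, by simp [abs_of_nonneg hc]⟩)
  obtain ⟨p, hp, hp0, n, hn⟩ := key a ha hcon.1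
  obtain ⟨q, hq, hq0, k, hk⟩ := key b hb hcon.2
  have h1 : |g| ≤ (p + q) + (n + k) • a :=
    hn.trans (add_le_add (le_add_of_nonneg_right hq0)
      (nsmul_le_nsmul_left ha (Nat.le_add_right n k)))
  have h2 : |g| ≤ (p + q) + (n + k) • b :=
    hk.trans (add_le_add (le_add_of_nonneg_left hp0)
      (nsmul_le_nsmul_left hb (Nat.le_add_left k n)))
  have h3 := le_inf h1 h2
  rw [← add_inf, nsmul_inf_nsmul_eq_zero hab, add_zero] at h3
  exact hP.prop.2 (hP.prop.1 g (p + q) (P.add_mem hp hq)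
    (by rwa [abs_of_nonneg (add_nonneg hp0 hq0)]))

/-- Every nonzero element of an abelian ℓ-group has a nonzero image in some totally ordered quotient. -/
theorem exists_chain_hom {G : Type} [Lattice G] [AddCommGroup G] [AddLeftMono G] {g : G}
    (hg : g ≠ 0) :
    ∃ (H : Type) (_ : AddCommGroup H) (_ : LinearOrder H) (_ : IsOrderedAddMonoid H) (π : G →+ H),
      (∀ a b, π (a ⊔ b) = π a ⊔ π b) ∧ π g ≠ 0 := by
  obtain ⟨P, hsolid, hgP, hprime⟩ := exists_prime_solid_addSubgroup hg
  have hpart : ∀ x : G, x⁺ ∈ P ∨ x⁻ ∈ P := fun x => hprime _ _ (posPart_inf_negPart_eq_zero x)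
  let C : AddGroupCone (G ⧸ P) :=
    { (AddSubmonoid.nonneg G).map (QuotientAddGroup.mk' P) with
      eq_zero_of_mem_of_neg_mem' := by
        rintro _ ⟨x, (hx : 0 ≤ x), rfl⟩ ⟨y, (hy : 0 ≤ y), hxy⟩
        have h : y + x ∈ P := by
          rw [← QuotientAddGroup.eq_zero_iff]
          have := eq_neg_iff_add_eq_zero.1 hxy
          simpa using this
        refine (QuotientAddGroup.eq_zero_iff x).2 (hsolid x _ h ?_)
        rw [abs_of_nonneg hx, abs_of_nonneg (add_nonneg hy hx)]
        exact le_add_of_nonneg_left hy }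
  have : HasMemOrNegMem C := ⟨by
    intro q
    obtain ⟨x, rfl⟩ := QuotientAddGroup.mk_surjective q
    have hx : (x : G ⧸ P) = ((x⁺ : G) : G ⧸ P) - ((x⁻ : G) : G ⧸ P) := by
      rw [← QuotientAddGroup.mk_sub, posPart_sub_negPart]
    rcases hpart x with h | h
    · right
      refine ⟨x⁻, negPart_nonneg x, ?_⟩
      rw [hx, (QuotientAddGroup.eq_zero_iff _).2 h]
      simp
    · left
      refine ⟨x⁺, posPart_nonneg x, ?_⟩
      rw [hx, (QuotientAddGroup.eq_zero_iff _).2 h]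
      simp⟩
  classical
  let : LinearOrder (G ⧸ P) := LinearOrder.mkOfAddGroupCone C
  have : IsOrderedAddMonoid (G ⧸ P) := IsOrderedAddMonoid.mkOfCone C
  have hmono : Monotone (QuotientAddGroup.mk' P) := fun x y hxy => by
    change QuotientAddGroup.mk' P y - QuotientAddGroup.mk' P x ∈ C
    exact ⟨y - x, sub_nonneg.2 hxy, by simp⟩
  refine ⟨G ⧸ P, inferInstance, inferInstance, inferInstance, QuotientAddGroup.mk' P, fun a b => ?_,
    fun h => hgP ((QuotientAddGroup.eq_zero_iff g).1 h)⟩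
  refine le_antisymm ?_ (sup_le (hmono le_sup_left) (hmono le_sup_right))
  have hab : a ⊔ b = b + (a - b)⁺ := by rw [posPart_def, add_sup]; simp
  have hab' : a ⊔ b = a + (a - b)⁻ := by rw [negPart_def, add_sup]; simp [sup_comm]
  rcases hpart (a - b) with h | h
  · rw [hab, map_add, show QuotientAddGroup.mk' P (a - b)⁺ = 0 from
      (QuotientAddGroup.eq_zero_iff _).2 h, add_zero]
    exact le_sup_right
  · rw [hab', map_add, show QuotientAddGroup.mk' P (a - b)⁻ = 0 from
      (QuotientAddGroup.eq_zero_iff _).2 h, add_zero]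
    exact le_sup_left

/-- The hoop operations on the whole of a lattice-ordered group. -/
instance hoopStructureGroup (G : Type*) [Lattice G] [AddCommGroup G] : HoopLang.Structure G where
  funMap {n} f x :=
    match n, f, x with
    | 0, _, _ => 0
    | 1, f, _ => f.elim
    | 2, HoopBin.add, x => x 0 + x 1
    | 2, HoopBin.tsub, x => (x 0 - x 1) ⊔ 0
    | (_+3), f, _ => f.elim
  RelMap {_} r := r.elim

theorem hoopTerm_induction {α : Type*} {P : HoopLang.Term α → Prop} (var : ∀ a, P (.var a))
    (zero : ∀ f ts, P (Term.func (L := HoopLang) (l := 0) f ts))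
    (add : ∀ ts : Fin 2 → HoopLang.Term α, P (ts 0) → P (ts 1) →
      P (Term.func (L := HoopLang) (l := 2) HoopBin.add ts))
    (tsub : ∀ ts : Fin 2 → HoopLang.Term α, P (ts 0) → P (ts 1) →
      P (Term.func (L := HoopLang) (l := 2) HoopBin.tsub ts)) : ∀ t, P t
  | .var a => var a
  | .func (l := 0) f ts => zero f ts
  | .func (l := 1) f _ => Empty.elim f
  | .func (l := 2) HoopBin.add ts =>
    add ts (hoopTerm_induction var zero add tsub (ts 0)) (hoopTerm_induction var zero add tsub (ts 1))
  | .func (l := 2) HoopBin.tsub ts =>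
    tsub ts (hoopTerm_induction var zero add tsub (ts 0)) (hoopTerm_induction var zero add tsub (ts 1))
  | .func (l := _ + 3) f _ => Empty.elim f

theorem realize_hoop_zero {α G : Type*} [Lattice G] [AddCommGroup G] (y : α → G)
    (f : HoopLang.Functions 0) (ts : Fin 0 → HoopLang.Term α) :
    (Term.func f ts).realize y = 0 := rfl

theorem realize_hoop_add {α G : Type*} [Lattice G] [AddCommGroup G] (y : α → G)
    (ts : Fin 2 → HoopLang.Term α) :
    (Term.func (L := HoopLang) (l := 2) HoopBin.add ts).realize y =
      (ts 0).realize y + (ts 1).realize y := rfl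

theorem realize_hoop_tsub {α G : Type*} [Lattice G] [AddCommGroup G] (y : α → G)
    (ts : Fin 2 → HoopLang.Term α) :
    (Term.func (L := HoopLang) (l := 2) HoopBin.tsub ts).realize y =
      ((ts 0).realize y - (ts 1).realize y) ⊔ 0 := rfl

theorem realize_posCone {α G : Type*} [Lattice G] [AddCommGroup G] [AddLeftMono G]
    (y : α → {x : G // 0 ≤ x}) (t : HoopLang.Term α) :
    ((t.realize y : {x : G // 0 ≤ x}) : G) = t.realize (fun a => (y a : G)) := by
  induction t using hoopTerm_induction with
  | var a => rfl
  | zero f ts => rfl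
  | add ts h₀ h₁ => rw [realize_hoop_add, ← h₀, ← h₁]; rfl
  | tsub ts h₀ h₁ => rw [realize_hoop_tsub, ← h₀, ← h₁]; rfl

theorem realize_map_hoop {α G H : Type*} [Lattice G] [AddCommGroup G] [Lattice H] [AddCommGroup H]
    (π : G →+ H) (hπ : ∀ a b, π (a ⊔ b) = π a ⊔ π b) (y : α → G) (t : HoopLang.Term α) :
    t.realize (fun a => π (y a)) = π (t.realize y) := by
  induction t using hoopTerm_induction with
  | var a => rfl
  | zero f ts => simp only [realize_hoop_zero, map_zero]
  | add ts h₀ h₁ => rw [realize_hoop_add, realize_hoop_add, h₀, h₁, map_add]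
  | tsub ts h₀ h₁ => rw [realize_hoop_tsub, realize_hoop_tsub, h₀, h₁, hπ, map_sub, map_zero]

theorem continuous_realize_hoop {α : Type*} (t : HoopLang.Term α) :
    Continuous fun y : α → ℝ => t.realize y := by
  induction t using hoopTerm_induction with
  | var a => exact continuous_apply a
  | zero f ts => exact continuous_const
  | add ts h₀ h₁ => exact h₀.add h₁
  | tsub ts h₀ h₁ => exact (h₀.sub h₁).max continuous_const

/-- The value at `y` of the linear form with integer coefficients `l`. -/
def intForm {V G : Type*} [Fintype V] [AddCommGroup G] (l : V → ℤ) (y : V → G) : G :=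
  ∑ v, l v • y v

section IntForm

variable {V G H : Type*} [Fintype V] [AddCommGroup G] [AddCommGroup H]

theorem intForm_add (l l' : V → ℤ) (y : V → G) :
    intForm (l + l') y = intForm l y + intForm l' y := by
  simp [intForm, add_smul, Finset.sum_add_distrib]

theorem intForm_sub (l l' : V → ℤ) (y : V → G) :
    intForm (l - l') y = intForm l y - intForm l' y := by
  simp [intForm, sub_smul, Finset.sum_sub_distrib]

theorem intForm_smul (c : ℤ) (l : V → ℤ) (y : V → G) :
    intForm (c • l) y = c • intForm l y := by
  simp [intForm, mul_smul, Finset.smul_sum]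

theorem intForm_zero (y : V → G) : intForm (0 : V → ℤ) y = 0 := by simp [intForm]

theorem intForm_single [DecidableEq V] (v : V) (y : V → G) : intForm (Pi.single v 1) y = y v := by
  simp [intForm, Pi.single_apply, ite_smul]

theorem intForm_map (π : G →+ H) (l : V → ℤ) (y : V → G) :
    intForm l (fun v => π (y v)) = π (intForm l y) := by
  simp [intForm]

end IntForm

/-- Two tuples give each of the forms in `Λ` values of the same sign. -/
def SameSign {V G H : Type*} [Fintype V] [AddCommGroup G] [LT G] [AddCommGroup H] [LT H]
    (Λ : Set (V → ℤ)) (x : V → G) (y : V → H) : Prop :=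
  ∀ l ∈ Λ, (0 < intForm l x ↔ 0 < intForm l y) ∧ (intForm l x < 0 ↔ intForm l y < 0)

section SameSign

variable {V G H : Type*} [Fintype V] [AddCommGroup G] [LinearOrder G] [AddCommGroup H]
  [LinearOrder H] {Λ Λ' : Set (V → ℤ)} {x : V → G} {y : V → H} {l : V → ℤ}

theorem SameSign.mono (h : SameSign Λ' x y) (hΛ : Λ ⊆ Λ') : SameSign Λ x y :=
  fun l hl => h l (hΛ hl)

theorem SameSign.symm (h : SameSign Λ x y) : SameSign Λ y x :=
  fun l hl => ⟨(h l hl).1.symm, (h l hl).2.symm⟩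

theorem SameSign.nonneg_iff (h : SameSign Λ x y) (hl : l ∈ Λ) :
    0 ≤ intForm l x ↔ 0 ≤ intForm l y := by
  rw [← not_lt, ← not_lt, (h l hl).2]

theorem SameSign.nonpos_iff (h : SameSign Λ x y) (hl : l ∈ Λ) :
    intForm l x ≤ 0 ↔ intForm l y ≤ 0 := by
  rw [← not_lt, ← not_lt, (h l hl).1]

theorem SameSign.eq_zero_iff (h : SameSign Λ x y) (hl : l ∈ Λ) :
    intForm l x = 0 ↔ intForm l y = 0 := by
  rw [le_antisymm_iff, le_antisymm_iff, h.nonneg_iff hl, h.nonpos_iff hl]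

end SameSign

/-- On chains, the signs of finitely many linear forms determine which of finitely many linear
forms a hoop term agrees with. -/
theorem exists_forms_realize {V : Type} [Fintype V] (t : HoopLang.Term V) :
    ∃ Λ Φ : Set (V → ℤ), Λ.Finite ∧ Φ.Finite ∧ ∀ (G H : Type)
      [AddCommGroup G] [LinearOrder G] [IsOrderedAddMonoid G]
      [AddCommGroup H] [LinearOrder H] [IsOrderedAddMonoid H] (x : V → G) (y : V → H),
      SameSign Λ x y → ∃ l ∈ Φ, t.realize x = intForm l x ∧ t.realize y = intForm l y := by
  classical
  induction t using hoopTerm_induction with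
  | var a =>
    exact ⟨∅, {Pi.single a 1}, Set.finite_empty, Set.finite_singleton _, fun G H _ _ _ _ _ _ x y _ =>
      ⟨_, rfl, (intForm_single a x).symm, (intForm_single a y).symm⟩⟩
  | zero f ts =>
    exact ⟨∅, {0}, Set.finite_empty, Set.finite_singleton _, fun G H _ _ _ _ _ _ x y _ =>
      ⟨_, rfl, (intForm_zero x).symm, (intForm_zero y).symm⟩⟩
  | add ts h₀ h₁ =>
    obtain ⟨Λ₀, Φ₀, hΛ₀, hΦ₀, h₀⟩ := h₀
    obtain ⟨Λ₁, Φ₁, hΛ₁, hΦ₁, h₁⟩ := h₁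
    refine ⟨Λ₀ ∪ Λ₁, Set.image2 (· + ·) Φ₀ Φ₁, hΛ₀.union hΛ₁, hΦ₀.image2 _ hΦ₁,
      fun G H _ _ _ _ _ _ x y h => ?_⟩
    obtain ⟨l₀, hl₀, hx₀, hy₀⟩ := h₀ G H x y (h.mono Set.subset_union_left)
    obtain ⟨l₁, hl₁, hx₁, hy₁⟩ := h₁ G H x y (h.mono Set.subset_union_right)
    exact ⟨l₀ + l₁, Set.mem_image2_of_mem hl₀ hl₁, by
      rw [realize_hoop_add, hx₀, hx₁, intForm_add], by
      rw [realize_hoop_add, hy₀, hy₁, intForm_add]⟩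
  | tsub ts h₀ h₁ =>
    obtain ⟨Λ₀, Φ₀, hΛ₀, hΦ₀, h₀⟩ := h₀
    obtain ⟨Λ₁, Φ₁, hΛ₁, hΦ₁, h₁⟩ := h₁
    refine ⟨Λ₀ ∪ Λ₁ ∪ Set.image2 (· - ·) Φ₀ Φ₁, Set.image2 (· - ·) Φ₀ Φ₁ ∪ {0},
      (hΛ₀.union hΛ₁).union (hΦ₀.image2 _ hΦ₁), (hΦ₀.image2 _ hΦ₁).union (Set.finite_singleton _),
      fun G H _ _ _ _ _ _ x y h => ?_⟩
    obtain ⟨l₀, hl₀, hx₀, hy₀⟩ := h₀ G H x y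
      (h.mono (Set.subset_union_left.trans Set.subset_union_left))
    obtain ⟨l₁, hl₁, hx₁, hy₁⟩ := h₁ G H x y
      (h.mono (Set.subset_union_right.trans Set.subset_union_left))
    have hmem : l₀ - l₁ ∈ Set.image2 (· - ·) Φ₀ Φ₁ := Set.mem_image2_of_mem hl₀ hl₁
    have hsign := h.nonneg_iff (Or.inr hmem)
    rw [realize_hoop_tsub, realize_hoop_tsub, hx₀, hx₁, hy₀, hy₁, ← intForm_sub, ← intForm_sub]
    by_cases hle : 0 ≤ intForm (l₀ - l₁) x
    · exact ⟨_, Or.inl hmem, sup_eq_left.2 hle, sup_eq_left.2 (hsign.1 hle)⟩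
    · refine ⟨0, Or.inr rfl, ?_, ?_⟩ <;> rw [intForm_zero]
      · exact sup_eq_right.2 (le_of_not_ge hle)
      · exact sup_eq_right.2 (le_of_not_ge fun h' => hle (hsign.2 h'))

/-- `Sol φ y` says that `y` is a tuple of nonnegative elements solving the equations of `φ`. -/
def EFDSystem.Sol (φ : EFDSystem HoopLang) {G : Type*} [Lattice G] [AddCommGroup G]
    (y : Fin φ.n ⊕ Fin φ.m → G) : Prop :=
  (∀ v, 0 ≤ y v) ∧ ∀ i, (φ.lhs i).realize y = (φ.rhs i).realize y

theorem EFDSystem.satisfies_posCone_iff (φ : EFDSystem HoopLang) (G : Type*) [Lattice G]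
    [AddCommGroup G] [AddLeftMono G] :
    φ.Satisfies {x : G // 0 ≤ x} ↔
      ∀ x : Fin φ.n → G, (∀ i, 0 ≤ x i) → ∃! z : Fin φ.m → G, φ.Sol (Sum.elim x z) := by
  have key : ∀ (x : Fin φ.n → {x : G // 0 ≤ x}) (z : Fin φ.m → {x : G // 0 ≤ x}),
      (∀ i, (φ.lhs i).realize (Sum.elim x z) = (φ.rhs i).realize (Sum.elim x z)) ↔
      φ.Sol (Sum.elim (fun i => (x i : G)) (fun j => (z j : G))) := by
    intro x z
    have h : (fun v => ((Sum.elim x z v : {x : G // 0 ≤ x}) : G)) =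
        Sum.elim (fun i => (x i : G)) (fun j => (z j : G)) := by
      ext v; cases v <;> rfl
    simp only [EFDSystem.Sol, Subtype.ext_iff, realize_posCone, h]
    refine ⟨fun h' => ⟨fun v => ?_, h'⟩, fun h' => h'.2⟩
    cases v with
    | inl i => exact (x i).2
    | inr j => exact (z j).2
  constructor
  · intro h x hx
    obtain ⟨z, hz, huniq⟩ := h fun i => ⟨x i, hx i⟩
    refine ⟨fun j => z j, (key _ _).1 hz, fun w hw => ?_⟩
    have := huniq (fun j => ⟨w j, hw.1 (Sum.inr j)⟩) ((key _ _).2 hw)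
    ext j
    exact congrArg Subtype.val (congrFun this j)
  · intro h x
    obtain ⟨z, hz, huniq⟩ := h (fun i => x i) fun i => (x i).2
    refine ⟨fun j => ⟨z j, hz.1 (Sum.inr j)⟩, (key _ _).2 hz, fun w hw => ?_⟩
    have := huniq (fun j => w j) ((key _ _).1 hw)
    ext j
    exact congrFun this j

theorem EFDSystem.Sol.map {φ : EFDSystem HoopLang} {G H : Type*} [Lattice G] [AddCommGroup G]
    [Lattice H] [AddCommGroup H] {y : Fin φ.n ⊕ Fin φ.m → G} (h : φ.Sol y)
    (π : G →+ H) (hπ : ∀ a b, π (a ⊔ b) = π a ⊔ π b) : φ.Sol fun v => π (y v) := by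
  refine ⟨fun v => ?_, fun i => ?_⟩
  · rw [← map_zero π, ← sup_eq_left, ← hπ, sup_eq_left.2 (h.1 v)]
  · rw [realize_map_hoop π hπ, realize_map_hoop π hπ, h.2 i]

theorem eq_of_forall_chain_hom {G : Type} [Lattice G] [AddCommGroup G] [AddLeftMono G] {a b : G}
    (h : ∀ (H : Type) [AddCommGroup H] [LinearOrder H] [IsOrderedAddMonoid H] (π : G →+ H),
      (∀ a b, π (a ⊔ b) = π a ⊔ π b) → π a = π b) : a = b := by
  by_contra hab
  obtain ⟨H, _, _, _, π, hπ, hne⟩ := exists_chain_hom (sub_ne_zero.2 hab)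
  exact hne (by rw [map_sub, h H π hπ, sub_self])

theorem EFDSystem.sol_of_forall_chain_hom {φ : EFDSystem HoopLang} {G : Type} [Lattice G]
    [AddCommGroup G] [AddLeftMono G] {y : Fin φ.n ⊕ Fin φ.m → G}
    (h : ∀ (H : Type) [AddCommGroup H] [LinearOrder H] [IsOrderedAddMonoid H] (π : G →+ H),
      (∀ a b, π (a ⊔ b) = π a ⊔ π b) → φ.Sol fun v => π (y v)) : φ.Sol y := by
  refine ⟨fun v => ?_, fun i => eq_of_forall_chain_hom fun H _ _ _ π hπ => ?_⟩
  · rw [← sup_eq_left]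
    refine eq_of_forall_chain_hom fun H _ _ _ π hπ => ?_
    rw [hπ, map_zero, sup_eq_left]
    exact (h H π hπ).1 v
  · rw [← realize_map_hoop π hπ, ← realize_map_hoop π hπ, (h H π hπ).2 i]

/-- On chains, being a solution is determined by the signs of finitely many linear forms. -/
theorem EFDSystem.exists_forms_sol (φ : EFDSystem HoopLang) :
    ∃ Λ : Set (Fin φ.n ⊕ Fin φ.m → ℤ), Λ.Finite ∧ ∀ (G H : Type)
      [AddCommGroup G] [LinearOrder G] [IsOrderedAddMonoid G]
      [AddCommGroup H] [LinearOrder H] [IsOrderedAddMonoid H]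
      (x : Fin φ.n ⊕ Fin φ.m → G) (y : Fin φ.n ⊕ Fin φ.m → H),
      SameSign Λ x y → φ.Sol x → φ.Sol y := by
  classical
  choose Λl Φl hΛl hΦl hl using fun i => exists_forms_realize (φ.lhs i)
  choose Λr Φr hΛr hΦr hr using fun i => exists_forms_realize (φ.rhs i)
  refine ⟨(Set.range fun v => Pi.single v 1) ∪
      ⋃ i, (Λl i ∪ Λr i ∪ Set.image2 (· - ·) (Φl i) (Φr i)),
    (Set.finite_range _).union (Set.finite_iUnion fun i =>
      ((hΛl i).union (hΛr i)).union ((hΦl i).image2 _ (hΦr i))), ?_⟩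
  intro G H _ _ _ _ _ _ x y h hx
  refine ⟨fun v => ?_, fun i => ?_⟩
  · have := h.nonneg_iff (Or.inl ⟨v, rfl⟩)
    rw [intForm_single, intForm_single] at this
    exact this.1 (hx.1 v)
  · have hi := h.mono (Set.subset_union_right.trans' (Set.subset_iUnion _ i))
    obtain ⟨l, hlΦ, hlx, hly⟩ := hl i G H x y
      (hi.mono (Set.subset_union_left.trans Set.subset_union_left))
    obtain ⟨r, hrΦ, hrx, hry⟩ := hr i G H x y
      (hi.mono (Set.subset_union_right.trans Set.subset_union_left))
    have := hi.eq_zero_iff (Or.inr (Set.mem_image2_of_mem hlΦ hrΦ))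
    rw [intForm_sub, intForm_sub, sub_eq_zero, sub_eq_zero, ← hlx, ← hrx, ← hly, ← hry] at this
    exact this.1 (hx.2 i)

theorem intForm_succ {d : ℕ} {G : Type*} [AddCommGroup G] (l : Fin (d + 1) → ℤ) (y : Fin (d + 1) → G) :
    intForm l y = l 0 • y 0 + intForm (Fin.tail l) (Fin.tail y) := by
  simp [intForm, Fin.sum_univ_succ, Fin.tail]

theorem intForm_neg {V G : Type*} [Fintype V] [AddCommGroup G] (l : V → ℤ) (y : V → G) :
    intForm (-l) y = -intForm l y := by
  simp [intForm]

theorem zsmul_pos_iff_of_pos {H : Type*} [AddCommGroup H] [LinearOrder H] [IsOrderedAddMonoid H]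
    {c : ℤ} (hc : 0 < c) {a : H} : 0 < c • a ↔ 0 < a := by
  refine ⟨fun h => ?_, fun h => zsmul_pos h hc⟩
  by_contra ha
  have := zsmul_nonneg (neg_nonneg.2 (not_lt.1 ha)) hc.le
  rw [smul_neg, neg_nonneg] at this
  exact absurd h this.not_gt

theorem zsmul_neg_iff_of_pos {H : Type*} [AddCommGroup H] [LinearOrder H] [IsOrderedAddMonoid H]
    {c : ℤ} (hc : 0 < c) {a : H} : c • a < 0 ↔ a < 0 := by
  rw [← neg_pos, ← smul_neg, zsmul_pos_iff_of_pos hc, neg_pos]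

/-- Fourier–Motzkin elimination: the sign pattern of finitely many integer linear forms at a tuple
of elements of a chain is attained over the rationals. -/
theorem exists_rat_sameSign {H : Type*} [AddCommGroup H] [LinearOrder H] [IsOrderedAddMonoid H]
    (d : ℕ) (Λ : Set (Fin d → ℤ)) (hΛ : Λ.Finite) (x : Fin d → H) :
    ∃ y : Fin d → ℚ, SameSign Λ x y := by
  induction d with
  | zero => exact ⟨0, fun l _ => by simp [intForm]⟩
  | succ d ih =>
    let S : Set (Fin (d + 1) → ℤ) := Λ ∪ Neg.neg '' Λ
    have hS : S.Finite := hΛ.union (hΛ.image _)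
    let elim (l u : Fin (d + 1) → ℤ) : Fin d → ℤ := l 0 • Fin.tail u - u 0 • Fin.tail l
    obtain ⟨y, hy⟩ := ih (Set.image2 elim S S ∪ Fin.tail '' S)
      ((hS.image2 _ hS).union (hS.image _)) (Fin.tail x)
    have helim : ∀ l u, intForm (elim l u) (Fin.tail x) = l 0 • intForm u x - u 0 • intForm l x := by
      intro l u
      rw [intForm_sub, intForm_smul, intForm_smul, intForm_succ, intForm_succ l, smul_add, smul_add,
        smul_comm]
      abel
    have helim' : ∀ l u, intForm (elim l u) y =
        l 0 * intForm (Fin.tail u) y - u 0 * intForm (Fin.tail l) y := by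
      intro l u
      rw [intForm_sub, intForm_smul, intForm_smul, zsmul_eq_mul, zsmul_eq_mul]
    have hsign : ∀ l ∈ S, ∀ u ∈ S, _ := fun l hl u hu =>
      hy (elim l u) (Or.inl (Set.mem_image2_of_mem hl hu))
    suffices hmain : ∃ a : ℚ, ∀ l ∈ S, 0 < l 0 →
        (0 < intForm l x ↔ 0 < l 0 * a + intForm (Fin.tail l) y) ∧
        (intForm l x < 0 ↔ l 0 * a + intForm (Fin.tail l) y < 0) by
      obtain ⟨a, ha⟩ := hmain
      have hcons : ∀ l : Fin (d + 1) → ℤ, intForm l (Fin.cons a y : Fin (d + 1) → ℚ) =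
          l 0 * a + intForm (Fin.tail l) y := by
        intro l
        rw [intForm_succ, Fin.tail_cons, Fin.cons_zero, zsmul_eq_mul]
      refine ⟨Fin.cons a y, fun l hl => ?_⟩
      rcases lt_trichotomy (l 0) 0 with h0 | h0 | h0
      · have := ha (-l) (Or.inr ⟨l, hl, rfl⟩) (by simpa using h0)
        rw [← hcons, intForm_neg, intForm_neg, neg_pos, neg_pos, neg_lt_zero, neg_lt_zero] at this
        exact this.symm
      · have := hy (Fin.tail l) (Or.inr ⟨l, Or.inl hl, rfl⟩)
        rw [hcons, intForm_succ, h0]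
        simpa using this
      · have := ha l (Or.inl hl) h0
        rwa [← hcons] at this
    by_cases hE : ∃ e ∈ S, 0 < e 0 ∧ intForm e x = 0
    · obtain ⟨e, he, he0, hex⟩ := hE
      have heq : (0 : ℚ) < e 0 := by exact_mod_cast he0
      refine ⟨-intForm (Fin.tail e) y / e 0, fun l hl hl0 => ?_⟩
      have h := hsign e he l hl
      have hval : intForm (elim e l) y =
          e 0 * (l 0 * (-intForm (Fin.tail e) y / e 0) + intForm (Fin.tail l) y) := by
        rw [helim']
        field_simp
        ring
      rw [helim, hex, smul_zero, sub_zero, hval, mul_pos_iff_of_pos_left heq,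
        ← smul_eq_mul (e 0 : ℚ), smul_neg_iff_of_pos_left heq] at h
      rwa [zsmul_pos_iff_of_pos he0, zsmul_neg_iff_of_pos he0] at h
    · push Not at hE
      let r (l : Fin (d + 1) → ℤ) : ℚ := -intForm (Fin.tail l) y / l 0
      obtain ⟨a, hlo, hhi⟩ := Order.exists_between_finsets
        ((hS.subset (Set.sep_subset S fun l => 0 < l 0 ∧ 0 < intForm l x)).image r).toFinset
        ((hS.subset (Set.sep_subset S fun l => 0 < l 0 ∧ intForm l x < 0)).image r).toFinset (by
          simp only [Set.Finite.mem_toFinset]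
          rintro _ ⟨l, ⟨hl, hl0, hlx⟩, rfl⟩ _ ⟨u, ⟨hu, hu0, hux⟩, rfl⟩
          have hneg : intForm (elim l u) y < 0 := by
            rw [← (hsign l hl u hu).2, helim, sub_neg]
            have h1 : 0 < u 0 • intForm l x := (zsmul_pos_iff_of_pos hu0).2 hlx
            have h2 : 0 < l 0 • -intForm u x := (zsmul_pos_iff_of_pos hl0).2 (neg_pos.2 hux)
            rw [smul_neg, neg_pos] at h2
            exact h2.trans h1
          rw [helim'] at hneg
          have hl0' : (0 : ℚ) < l 0 := by exact_mod_cast hl0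
          have hu0' : (0 : ℚ) < u 0 := by exact_mod_cast hu0
          simp only [r]
          rw [div_lt_div_iff₀ hl0' hu0']
          linarith)
      simp only [Set.Finite.mem_toFinset] at hlo hhi
      have hroot : ∀ l : Fin (d + 1) → ℤ, 0 < l 0 →
          l 0 * a + intForm (Fin.tail l) y = l 0 * (a - r l) := by
        intro l hl0
        have hl0' : (0 : ℚ) < l 0 := by exact_mod_cast hl0
        simp only [r]
        field_simp
        ring
      refine ⟨a, fun l hl hl0 => ?_⟩
      have hl0' : (0 : ℚ) < l 0 := by exact_mod_cast hl0
      rw [hroot l hl0, mul_pos_iff_of_pos_left hl0', ← smul_eq_mul (l 0 : ℚ), smul_neg_iff_of_pos_left hl0', sub_pos, sub_neg]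
      rcases lt_or_gt_of_ne (hE l hl hl0) with h | h
      · have := hhi _ ⟨l, ⟨hl, hl0, h⟩, rfl⟩
        exact ⟨iff_of_false h.not_gt this.not_gt, iff_of_true h this⟩
      · have := hlo _ ⟨l, ⟨hl, hl0, h⟩, rfl⟩
        exact ⟨iff_of_true h this, iff_of_false h.not_gt this.not_gt⟩

theorem exists_common_denominator {ι : Type*} [Finite ι] (y : ι → ℚ) :
    ∃ N : ℕ, 0 < N ∧ ∃ w : ι → ℤ, ∀ i, (N : ℚ) * y i = w i := by
  classical
  have := Fintype.ofFinite ι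
  refine ⟨∏ i, (y i).den, Finset.prod_pos fun i _ => (y i).pos,
    fun i => (∏ k ∈ Finset.univ.erase i, (y k).den : ℕ) * (y i).num, fun i => ?_⟩
  rw [← Finset.prod_erase_mul _ _ (Finset.mem_univ i)]
  push_cast
  rw [mul_assoc, Rat.den_mul_eq_num]

/-- The sign pattern of finitely many integer linear forms at a tuple of elements of a chain is
attained over the integers. -/
theorem exists_int_sameSign {V H : Type*} [Fintype V] [AddCommGroup H] [LinearOrder H]
    [IsOrderedAddMonoid H] {Λ : Set (V → ℤ)} (hΛ : Λ.Finite) (x : V → H) :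
    ∃ y : V → ℤ, SameSign Λ x y := by
  let e := Fintype.equivFin V
  obtain ⟨y, hy⟩ := exists_rat_sameSign _ ((fun l => l ∘ e.symm) '' Λ) (hΛ.image _) (x ∘ e.symm)
  obtain ⟨N, hN, w, hw⟩ := exists_common_denominator y
  refine ⟨w ∘ e, fun l hl => ?_⟩
  have h := hy _ ⟨l, hl, rfl⟩
  have hx : intForm (l ∘ e.symm) (x ∘ e.symm) = intForm l x :=
    e.symm.sum_comp fun v => l v • x v
  have hval : ((intForm l (w ∘ e) : ℤ) : ℚ) = N * intForm (l ∘ e.symm) y := by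
    rw [intForm, intForm, ← e.symm.sum_comp, Finset.mul_sum]
    push_cast
    refine Finset.sum_congr rfl fun i _ => ?_
    simp only [Function.comp_apply, Equiv.apply_symm_apply, smul_eq_mul, zsmul_eq_mul, Int.cast_mul,
      ← hw]
    ring
  have hN' : (0 : ℚ) < N := by exact_mod_cast hN
  rw [hx] at h
  rw [h.1, h.2, ← @Int.cast_pos ℚ, ← @Int.cast_lt_zero ℚ, hval, mul_pos_iff_of_pos_left hN',
    ← smul_eq_mul (N : ℚ), smul_neg_iff_of_pos_left hN']
  exact ⟨Iff.rfl, Iff.rfl⟩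

/-- The form on `W`-tuples obtained from a form on `V`-tuples by reindexing along `f : V → W`. -/
def pushForm {V W : Type*} [Fintype V] [DecidableEq W] (f : V → W) (l : V → ℤ) : W → ℤ :=
  fun w => ∑ v, if f v = w then l v else 0

theorem intForm_pushForm {V W G : Type*} [Fintype V] [Fintype W] [DecidableEq W] [AddCommGroup G]
    (f : V → W) (l : V → ℤ) (y : W → G) : intForm (pushForm f l) y = intForm l (y ∘ f) := by
  simp only [intForm, pushForm, Finset.sum_smul, ite_smul, zero_smul]
  rw [Finset.sum_comm]
  simp

theorem SameSign.comp {V W G H : Type*} [Fintype V] [Fintype W] [DecidableEq W] [AddCommGroup G]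
    [LinearOrder G] [AddCommGroup H] [LinearOrder H] {Λ : Set (V → ℤ)} {x : W → G} {y : W → H}
    {f : V → W} (h : SameSign (pushForm f '' Λ) x y) : SameSign Λ (x ∘ f) (y ∘ f) := fun l hl => by
  simpa only [intForm_pushForm] using h _ ⟨l, hl, rfl⟩

theorem EFDSystem.Sol.map_of_monotone {φ : EFDSystem HoopLang} {G H : Type*} [LinearOrder G]
    [AddCommGroup G] [Lattice H] [AddCommGroup H] {y : Fin φ.n ⊕ Fin φ.m → G} (h : φ.Sol y)
    (π : G →+ H) (hπ : Monotone π) : φ.Sol fun v => π (y v) :=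
  h.map π fun _ _ => hπ.map_sup _ _

theorem monotone_zmultiplesHom {G : Type*} [Lattice G] [AddCommGroup G] [AddLeftMono G] {a : G}
    (ha : 0 ≤ a) : Monotone (zmultiplesHom G a) := fun n k h => by
  have : IsOrderedAddMonoid G := { add_le_add_left := fun _ _ h _ => add_le_add_left h _ }
  simpa using zsmul_le_zsmul_left ha h

/-- Solutions of `φ` in chains are unique. -/
def EFDSystem.UniqueOnChains (φ : EFDSystem HoopLang) : Prop :=
  ∀ (H : Type) [AddCommGroup H] [LinearOrder H] [IsOrderedAddMonoid H]
    (x : Fin φ.n → H) (z w : Fin φ.m → H), φ.Sol (Sum.elim x z) → φ.Sol (Sum.elim x w) → z = w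

theorem exists_pos_of_nontrivial (A : Type*) [Lattice A] [AddCommGroup A] [AddLeftMono A]
    [Nontrivial A] : ∃ a : A, 0 ≤ a ∧ a ≠ 0 := by
  obtain ⟨b, hb⟩ := exists_ne (0 : A)
  refine ⟨|b|, abs_nonneg b, fun h => hb (le_antisymm ?_ ?_)⟩
  · exact (le_abs_self b).trans h.le
  · exact neg_nonpos.1 ((neg_le_abs b).trans h.le)

theorem zsmul_eq_zero_of_chain {G : Type} [Lattice G] [AddCommGroup G] [AddLeftMono G] {c : ℤ}
    (hc : c ≠ 0) {a : G} (h : c • a = 0) : a = 0 :=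
  eq_of_forall_chain_hom fun H _ _ _ π _ => by
    have := congrArg π h
    rw [map_zsmul, map_zero] at this
    rw [map_zero]
    exact (smul_eq_zero.1 this).resolve_left hc

theorem EFDSystem.uniqueOnChains_of_satisfies {φ : EFDSystem HoopLang} {A : Type} [Lattice A]
    [AddCommGroup A] [AddLeftMono A] [Nontrivial A] (hA : φ.Satisfies {x : A // 0 ≤ x}) :
    φ.UniqueOnChains := by
  classical
  intro H _ _ _ x z w hz hw
  by_contra hne
  obtain ⟨j, hj⟩ := Function.ne_iff.1 hne
  obtain ⟨Λ, hΛ, hsol⟩ := φ.exists_forms_sol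
  let f : Fin φ.n ⊕ Fin φ.m → Fin φ.n ⊕ (Fin φ.m ⊕ Fin φ.m) := Sum.map id Sum.inl
  let g : Fin φ.n ⊕ Fin φ.m → Fin φ.n ⊕ (Fin φ.m ⊕ Fin φ.m) := Sum.map id Sum.inr
  obtain ⟨y, hy⟩ := exists_int_sameSign (Λ := pushForm f '' Λ ∪ pushForm g '' Λ ∪
      {Pi.single (Sum.inr (Sum.inl j)) 1 - Pi.single (Sum.inr (Sum.inr j)) 1})
    (((hΛ.image _).union (hΛ.image _)).union (Set.finite_singleton _))
    (Sum.elim x (Sum.elim z w))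
  have hf := (hy.mono (Set.subset_union_left.trans Set.subset_union_left)).comp
  have hg := (hy.mono (Set.subset_union_right.trans Set.subset_union_left)).comp
  have hne' := hy.eq_zero_iff (Or.inr rfl)
  simp only [intForm_sub, intForm_single, Sum.elim_inr, Sum.elim_inl, sub_eq_zero] at hne'
  have hyf : φ.Sol (y ∘ f) := hsol H ℤ _ _ hf (by
    convert hz using 1; ext v; cases v <;> rfl)
  have hyg : φ.Sol (y ∘ g) := hsol H ℤ _ _ hg (by
    convert hw using 1; ext v; cases v <;> rfl)
  obtain ⟨a, ha, ha0⟩ := exists_pos_of_nontrivial A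
  have hsA := (φ.satisfies_posCone_iff A).1 hA
  have hmf := hyf.map_of_monotone _ (monotone_zmultiplesHom ha)
  have hmg := hyg.map_of_monotone _ (monotone_zmultiplesHom ha)
  have huniq := (hsA (fun i => zmultiplesHom A a (y (Sum.inl i))) fun i => hmf.1 (Sum.inl i)).unique
    (y₁ := fun k => zmultiplesHom A a (y (Sum.inr (Sum.inl k))))
    (y₂ := fun k => zmultiplesHom A a (y (Sum.inr (Sum.inr k))))
    (by convert hmf using 1; ext v; cases v <;> rfl)
    (by convert hmg using 1; ext v; cases v <;> rfl)
  have hjj := congrFun huniq j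
  simp only [zmultiplesHom_apply] at hjj
  rw [← sub_eq_zero, ← sub_smul] at hjj
  refine ha0 (zsmul_eq_zero_of_chain (sub_ne_zero.2 fun h => hj (hne'.2 h)) hjj)

theorem EFDSystem.UniqueOnChains.unique {φ : EFDSystem HoopLang} (hφ : φ.UniqueOnChains) {G : Type}
    [Lattice G] [AddCommGroup G] [AddLeftMono G] {x : Fin φ.n → G} {z w : Fin φ.m → G}
    (hz : φ.Sol (Sum.elim x z)) (hw : φ.Sol (Sum.elim x w)) : z = w := by
  ext j
  refine eq_of_forall_chain_hom fun H _ _ _ π hπ => congrFun (hφ H (fun i => π (x i))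
    (fun j => π (z j)) (fun j => π (w j)) ?_ ?_) j
  · convert hz.map π hπ using 1; ext v; cases v <;> rfl
  · convert hw.map π hπ using 1; ext v; cases v <;> rfl

theorem EFDSystem.Sol.mul_left {φ : EFDSystem HoopLang} {x : Fin φ.n → ℝ} {z : Fin φ.m → ℝ}
    (h : φ.Sol (Sum.elim x z)) {c : ℝ} (hc : 0 ≤ c) :
    φ.Sol (Sum.elim (fun i => c * x i) fun j => c * z j) := by
  convert h.map_of_monotone (AddMonoidHom.mulLeft c) (fun a b hab => mul_le_mul_of_nonneg_left hab hc)
    using 1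
  ext v; cases v <;> rfl

theorem EFDSystem.exists_sol_natCast_of_satisfies {φ : EFDSystem HoopLang} {A : Type} [Lattice A]
    [AddCommGroup A] [AddLeftMono A] [Nontrivial A] (hA : φ.Satisfies {x : A // 0 ≤ x})
    (q : Fin φ.n → ℕ) : ∃ z : Fin φ.m → ℝ, φ.Sol (Sum.elim (fun i => (q i : ℝ)) z) := by
  classical
  obtain ⟨a, ha, ha0⟩ := exists_pos_of_nontrivial A
  obtain ⟨z, hz, -⟩ := (φ.satisfies_posCone_iff A).1 hA (fun i => q i • a)
    fun i => nsmul_nonneg ha _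
  obtain ⟨H, _, _, _, π, hπ, hπa⟩ := exists_chain_hom ha0
  have hπpos : 0 < π a := lt_of_le_of_ne
    (by rw [← map_zero π, ← sup_eq_left, ← hπ, sup_eq_left.2 ha]) hπa.symm
  obtain ⟨Λ, hΛ, hsol⟩ := φ.exists_forms_sol
  obtain ⟨y, hy⟩ := exists_int_sameSign (V := (Fin φ.n ⊕ Fin φ.m) ⊕ Unit)
    (Λ := pushForm Sum.inl '' Λ ∪
      (Set.range fun i => Pi.single (Sum.inl (Sum.inl i)) 1 - (q i : ℤ) • Pi.single (Sum.inr ()) 1) ∪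
      {Pi.single (Sum.inr ()) 1})
    (((hΛ.image _).union (Set.finite_range _)).union (Set.finite_singleton _))
    (Sum.elim (fun v => π (Sum.elim (fun i => q i • a) z v)) fun _ => π a)
  have hS : φ.Sol (y ∘ Sum.inl) :=
    hsol H ℤ _ _ (hy.mono (Set.subset_union_left.trans Set.subset_union_left)).comp (hz.map π hπ)
  have hpos := (hy _ (Or.inr rfl)).1
  rw [intForm_single, intForm_single] at hpos
  replace hpos := hpos.1 hπpos
  have hx : ∀ i, y (Sum.inl (Sum.inl i)) = q i * y (Sum.inr ()) := by
    intro i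
    have := hy.eq_zero_iff (Or.inl (Or.inr ⟨i, rfl⟩))
    simp only [intForm_sub, intForm_smul, intForm_single, sub_eq_zero, Sum.elim_inl, Sum.elim_inr,
      smul_eq_mul] at this
    exact this.1 (by rw [map_nsmul, natCast_zsmul])
  have hpos' : (0 : ℝ) < y (Sum.inr ()) := by exact_mod_cast hpos
  have hR : φ.Sol (Sum.elim (fun i => (y (Sum.inl (Sum.inl i)) : ℝ))
      fun j => (y (Sum.inl (Sum.inr j)) : ℝ)) := by
    convert hS.map_of_monotone (Int.castAddHom ℝ) Int.cast_mono using 1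
    ext v; cases v <;> rfl
  refine ⟨fun j => (y (Sum.inr ()) : ℝ)⁻¹ * y (Sum.inl (Sum.inr j)), ?_⟩
  convert hR.mul_left (inv_nonneg.2 hpos'.le) using 3 with i
  rw [hx]
  push_cast
  field_simp

open Filter Topology in
/-- If every form in a finite set which vanishes at `y` also vanishes at `v`, then moving from `y`
slightly in the direction `v` preserves the signs of all forms. -/
theorem exists_pos_sameSign_add {V : Type*} [Fintype V] {Λ : Set (V → ℤ)} (hΛ : Λ.Finite)
    {y v : V → ℝ} (h : ∀ l ∈ Λ, intForm l y = 0 → intForm l v = 0) :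
    ∃ ε : ℝ, 0 < ε ∧ SameSign Λ y (y + ε • v) := by
  have hform : ∀ (l : V → ℤ) (ε : ℝ), intForm l (y + ε • v) = intForm l y + ε * intForm l v := by
    intro l ε
    simp only [intForm, Pi.add_apply, Pi.smul_apply, smul_eq_mul, zsmul_eq_mul, mul_add,
      Finset.sum_add_distrib, Finset.mul_sum]
    congr 1
    exact Finset.sum_congr rfl fun _ _ => by ring
  have hev : ∀ᶠ ε in 𝓝[>] (0 : ℝ), ∀ l ∈ Λ, (0 < intForm l y ↔ 0 < intForm l (y + ε • v)) ∧
      (intForm l y < 0 ↔ intForm l (y + ε • v) < 0) := by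
    refine (eventually_all_finite hΛ).2 fun l hl => ?_
    simp only [hform]
    have hlim : Tendsto (fun ε : ℝ => intForm l y + ε * intForm l v) (𝓝[>] 0)
        (𝓝 (intForm l y)) := by
      have : Continuous fun ε : ℝ => intForm l y + ε * intForm l v := by fun_prop
      simpa using (this.tendsto 0).mono_left nhdsWithin_le_nhds
    rcases lt_trichotomy (intForm l y) 0 with hneg | hzero | hpos
    · filter_upwards [hlim.eventually_lt_const hneg] with ε hε
      exact ⟨iff_of_false hneg.not_gt hε.not_gt, iff_of_true hneg hε⟩
    · simp [hzero, h l hl hzero]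
    · filter_upwards [hlim.eventually_const_lt hpos] with ε hε
      exact ⟨iff_of_true hpos hε, iff_of_false hpos.not_gt hε.not_gt⟩
  obtain ⟨ε, hε, hε0⟩ := (hev.and self_mem_nhdsWithin).exists
  exact ⟨ε, hε0, hε⟩

/-- The real linear map with rational matrix `d`. -/
def ratLin {n m : ℕ} (d : Fin m → Fin n → ℚ) (x : Fin n → ℝ) : Fin m → ℝ :=
  fun j => ∑ i, (d j i : ℝ) * x i

theorem EFDSystem.UniqueOnChains.exists_row {φ : EFDSystem HoopLang} (hφ : φ.UniqueOnChains)
    {Λ : Set (Fin φ.n ⊕ Fin φ.m → ℤ)} (hΛ : Λ.Finite)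
    (hsol : ∀ x y : Fin φ.n ⊕ Fin φ.m → ℝ, SameSign Λ x y → φ.Sol x → φ.Sol y)
    {y : Fin φ.n ⊕ Fin φ.m → ℝ} (hy : φ.Sol y) (j : Fin φ.m) :
    ∃ c : Fin φ.n → ℚ, ∀ y' : Fin φ.n ⊕ Fin φ.m → ℝ,
      (∀ l ∈ Λ, intForm l y = 0 → intForm l y' = 0) →
      y' (Sum.inr j) = ∑ i, (c i : ℝ) * y' (Sum.inl i) := by
  classical
  let S : Set (Fin φ.n ⊕ Fin φ.m → ℚ) :=
    (fun l v => (l v : ℚ)) '' {l | l ∈ Λ ∧ intForm l y = 0}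
  let E : Set (Fin φ.n ⊕ Fin φ.m → ℚ) := Set.range fun i => Pi.single (Sum.inl i) 1
  have hmem : (Pi.single (Sum.inr j) 1 : Fin φ.n ⊕ Fin φ.m → ℚ) ∈ Submodule.span ℚ (S ∪ E) := by
    by_contra hnot
    obtain ⟨f, hf, hker⟩ := Submodule.exists_le_ker_of_notMem hnot
    have hfker : ∀ s ∈ S ∪ E, f s = 0 := fun s hs => hker (Submodule.subset_span hs)
    let v : Fin φ.n ⊕ Fin φ.m → ℝ := fun u => (f (Pi.single u 1) : ℝ)
    obtain ⟨ε, hε, hsame⟩ := exists_pos_sameSign_add hΛ (y := y) (v := v) fun l hl h0 => by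
      have h := hfker _ (Or.inl ⟨l, ⟨hl, h0⟩, rfl⟩)
      rw [LinearMap.pi_apply_eq_sum_univ f] at h
      have hps : ∀ u : Fin φ.n ⊕ Fin φ.m,
          (fun u' => if u = u' then (1 : ℚ) else 0) = Pi.single u 1 := fun u => by
        ext u'; simp [Pi.single_apply, eq_comm]
      simp only [hps] at h
      have h' := congrArg (fun q : ℚ => (q : ℝ)) h
      simp only [smul_eq_mul, Rat.cast_sum, Rat.cast_mul, Rat.cast_intCast, Rat.cast_zero] at h'
      simp only [intForm, zsmul_eq_mul, v]
      exact h'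
    have hinl : ∀ i, v (Sum.inl i) = 0 := fun i => by
      simp [v, hfker _ (Or.inr ⟨i, rfl⟩)]
    have hy' : Sum.elim (y ∘ Sum.inl) (y ∘ Sum.inr) = y := Sum.elim_comp_inl_inr y
    have hyv : Sum.elim (y ∘ Sum.inl) ((y + ε • v) ∘ Sum.inr) = y + ε • v := by
      ext u; cases u <;> simp [hinl]
    have heq := hφ ℝ (y ∘ Sum.inl) (y ∘ Sum.inr) ((y + ε • v) ∘ Sum.inr) (hy'.symm ▸ hy)
      (hyv.symm ▸ hsol _ _ hsame hy)
    have := congrFun heq j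
    simp only [Function.comp_apply, Pi.add_apply, Pi.smul_apply, smul_eq_mul, left_eq_add, mul_eq_zero, hε.ne',
      false_or, v, Rat.cast_eq_zero] at this
    exact hf this
  rw [Submodule.span_union, Submodule.mem_sup] at hmem
  obtain ⟨s, hs, e, he, hse⟩ := hmem
  obtain ⟨c, rfl⟩ := (Submodule.mem_span_range_iff_exists_fun ℚ).1 he
  refine ⟨c, fun y' hy' => ?_⟩
  let g : (Fin φ.n ⊕ Fin φ.m → ℚ) →ₗ[ℚ] ℝ :=
    ∑ u, (LinearMap.proj u).smulRight (y' u)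
  have hg : ∀ t, g t = ∑ u, (t u : ℝ) * y' u := fun t => by
    simp [g, LinearMap.sum_apply, Rat.smul_def]
  have hgs : g s = 0 := by
    have : Submodule.span ℚ S ≤ LinearMap.ker g := Submodule.span_le.2 (by
      rintro _ ⟨l, ⟨hl, h0⟩, rfl⟩
      simpa [hg, intForm] using hy' l hl h0)
    exact this hs
  have hsingle : ∀ u, g (Pi.single u 1) = y' u := fun u => by
    rw [hg, Finset.sum_eq_single u] <;> simp +contextual
  have := congrArg g hse
  simpa only [map_add, hgs, zero_add, map_sum, map_smul, hsingle, Rat.smul_def] using this.symm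

/-- The solutions of `φ` in `ℝ` lie on the graphs of finitely many rational linear maps. -/
theorem EFDSystem.UniqueOnChains.exists_finite_ratLin {φ : EFDSystem HoopLang}
    (hφ : φ.UniqueOnChains) : ∃ D : Set (Fin φ.m → Fin φ.n → ℚ), D.Finite ∧
      ∀ (x : Fin φ.n → ℝ) (z : Fin φ.m → ℝ), φ.Sol (Sum.elim x z) → ∃ d ∈ D, z = ratLin d x := by
  classical
  obtain ⟨Λ, hΛ, hsol⟩ := φ.exists_forms_sol
  have hrow : ∀ Λ₀ : Set (Fin φ.n ⊕ Fin φ.m → ℤ), ∃ d : Fin φ.m → Fin φ.n → ℚ,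
      ∀ (x : Fin φ.n → ℝ) (z : Fin φ.m → ℝ), φ.Sol (Sum.elim x z) →
        {l | l ∈ Λ ∧ intForm l (Sum.elim x z) = 0} = Λ₀ → z = ratLin d x := by
    intro Λ₀
    by_cases h : ∃ y : Fin φ.n ⊕ Fin φ.m → ℝ, φ.Sol y ∧ {l | l ∈ Λ ∧ intForm l y = 0} = Λ₀
    · obtain ⟨y, hy, rfl⟩ := h
      choose d hd using fun j => hφ.exists_row hΛ (hsol ℝ ℝ) hy j
      refine ⟨d, fun x z _ hxz => funext fun j => ?_⟩
      exact hd j (Sum.elim x z) fun l hl h0 => ((Set.ext_iff.1 hxz l).2 ⟨hl, h0⟩).2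
    · exact ⟨0, fun x z hs hxz => (h ⟨_, hs, hxz⟩).elim⟩
  choose d hd using hrow
  exact ⟨d '' {Λ₀ | Λ₀ ⊆ Λ}, hΛ.finite_subsets.image d, fun x z hs =>
    ⟨_, ⟨_, fun l hl => hl.1, rfl⟩, hd _ x z hs rfl⟩⟩

theorem continuous_ratLin {n m : ℕ} (d : Fin m → Fin n → ℚ) : Continuous (ratLin d) := by
  unfold ratLin; fun_prop

theorem ratLin_mul {n m : ℕ} (d : Fin m → Fin n → ℚ) (c : ℝ) (x : Fin n → ℝ) :
    ratLin d (fun i => c * x i) = fun j => c * ratLin d x j := by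
  ext j
  simp only [ratLin, Finset.mul_sum]
  exact Finset.sum_congr rfl fun _ _ => by ring

/-- The points of the orthant at which the rational linear map `d` computes a solution. -/
def EFDSystem.solSet (φ : EFDSystem HoopLang) (d : Fin φ.m → Fin φ.n → ℚ) : Set (Fin φ.n → ℝ) :=
  {x | φ.Sol (Sum.elim x (ratLin d x))}

theorem EFDSystem.isClosed_solSet (φ : EFDSystem HoopLang) (d : Fin φ.m → Fin φ.n → ℚ) :
    IsClosed (φ.solSet d) := by
  have hc : Continuous fun x : Fin φ.n → ℝ => Sum.elim x (ratLin d x) := by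
    refine continuous_pi fun v => ?_
    cases v with
    | inl i => exact continuous_apply i
    | inr j => exact (continuous_apply j).comp (continuous_ratLin d)
  have hset : φ.solSet d = (⋂ v, {x | 0 ≤ Sum.elim x (ratLin d x) v}) ∩
      ⋂ i, {x | (φ.lhs i).realize (Sum.elim x (ratLin d x)) =
        (φ.rhs i).realize (Sum.elim x (ratLin d x))} := by
    ext x
    simp only [solSet, Sol, Set.mem_inter_iff, Set.mem_iInter, Set.mem_ofPred_eq]
  rw [hset]
  exact (isClosed_iInter fun v => isClosed_le continuous_const ((continuous_apply v).comp hc)).inter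
    (isClosed_iInter fun i => isClosed_eq ((continuous_realize_hoop _).comp hc)
      ((continuous_realize_hoop _).comp hc))

theorem EFDSystem.mul_mem_solSet {φ : EFDSystem HoopLang} {d : Fin φ.m → Fin φ.n → ℚ}
    {x : Fin φ.n → ℝ} (hx : x ∈ φ.solSet d) {c : ℝ} (hc : 0 ≤ c) :
    (fun i => c * x i) ∈ φ.solSet d := by
  have := EFDSystem.Sol.mul_left hx hc
  rwa [← ratLin_mul] at this

open Filter Topology in
/-- If `φ` is solvable at the natural points, then it is solvable on the whole orthant. -/
theorem EFDSystem.exists_mem_solSet {φ : EFDSystem HoopLang}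
    {D : Set (Fin φ.m → Fin φ.n → ℚ)} (hD : D.Finite)
    (hnat : ∀ q : Fin φ.n → ℕ, ∃ d ∈ D, (fun i => (q i : ℝ)) ∈ φ.solSet d)
    {x : Fin φ.n → ℝ} (hx : 0 ≤ x) : ∃ d ∈ D, x ∈ φ.solSet d := by
  have hclosed : IsClosed (⋃ d ∈ D, φ.solSet d) :=
    hD.isClosed_biUnion fun d _ => φ.isClosed_solSet d
  have hlim : Tendsto (fun (M : ℕ) i => (M : ℝ)⁻¹ * (⌈x i * M⌉₊ : ℝ)) atTop (𝓝 x) :=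
    tendsto_pi_nhds.2 fun i => by
      simpa only [Function.comp_def, div_eq_inv_mul] using
        (tendsto_nat_ceil_mul_div_atTop (hx i)).comp tendsto_natCast_atTop_atTop
  have hmem := hclosed.mem_of_tendsto hlim (Eventually.of_forall fun M => by
    obtain ⟨d, hd, hq⟩ := hnat fun i => ⌈x i * M⌉₊
    exact Set.mem_biUnion hd (mul_mem_solSet hq (by positivity)))
  simpa using hmem

/-- Finitely many closed sets covering a Baire space still do so after discarding those with empty
interior. -/
theorem exists_mem_interior_nonempty_of_cover {X ι : Type*} [TopologicalSpace X] [BaireSpace X]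
    {D : Set ι} (hD : D.Finite) {C : ι → Set X} (hC : ∀ d, IsClosed (C d))
    (hcover : ∀ x, ∃ d ∈ D, x ∈ C d) (x : X) :
    ∃ d ∈ D, (interior (C d)).Nonempty ∧ x ∈ C d := by
  have hdense : Dense (⋃ d ∈ D, interior (C d)) :=
    dense_biUnion_interior_of_closed (fun d _ => hC d) hD.countable (by
      ext x; simpa using hcover x)
  have hclosed : IsClosed (⋃ d ∈ {d ∈ D | (interior (C d)).Nonempty}, C d) :=
    (hD.subset fun _ h => h.1).isClosed_biUnion fun d _ => hC d
  have hsub : (⋃ d ∈ D, interior (C d)) ⊆ ⋃ d ∈ {d ∈ D | (interior (C d)).Nonempty}, C d :=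
    Set.iUnion₂_subset fun d hd y hy => Set.mem_biUnion ⟨hd, y, hy⟩ (interior_subset hy)
  have hx := hclosed.closure_subset_iff.2 hsub (hdense x)
  simpa [and_assoc] using hx

open Filter Topology in
/-- A set of orthant points which is closed under scaling and has nonempty relative interior
contains a natural point together with its upper neighbours. -/
theorem exists_nat_mem_of_interior_nonempty {n : ℕ} {C : Set (Fin n → ℝ)}
    (hC : ∀ x ∈ C, ∀ c : ℝ, 0 ≤ c → (fun i => c * x i) ∈ C)
    (hint : (interior (Subtype.val ⁻¹' C : Set (Set.Ici (0 : Fin n → ℝ)))).Nonempty) :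
    ∃ q : Fin n → ℕ, (fun i => (q i : ℝ)) ∈ C ∧
      ∀ i, (fun i' => ((q + Pi.single i 1 : Fin n → ℕ) i' : ℝ)) ∈ C := by
  obtain ⟨c, hc⟩ := hint
  have hc0 : ∀ i, 0 ≤ c.1 i := c.2
  have hmem : ∀ r : Fin n → ℕ, ∀ᶠ M : ℕ in atTop,
      (fun i => ((⌈c.1 i * M⌉₊ + r i : ℕ) : ℝ)) ∈ C := by
    intro r
    have hlim : Tendsto (fun (M : ℕ) => (⟨fun i => (M : ℝ)⁻¹ * ((⌈c.1 i * M⌉₊ + r i : ℕ) : ℝ),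
        fun i => by simp only [Pi.zero_apply]; positivity⟩ : Set.Ici (0 : Fin n → ℝ))) atTop (𝓝 c) := by
      rw [tendsto_subtype_rng]
      refine tendsto_pi_nhds.2 fun i => ?_
      have h1 := (tendsto_nat_ceil_mul_div_atTop (hc0 i)).comp
        (tendsto_natCast_atTop_atTop (R := ℝ))
      have h2 := (tendsto_inv_atTop_zero.comp (tendsto_natCast_atTop_atTop (R := ℝ))).mul_const
        (r i : ℝ)
      simpa only [Function.comp_def, div_eq_inv_mul, Nat.cast_add, mul_add, zero_mul, add_zero]
        using h1.add h2
    filter_upwards [hlim.eventually (isOpen_interior.mem_nhds hc), eventually_gt_atTop 0] with M hM hM0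
    have hM0' : (M : ℝ) ≠ 0 := by positivity
    have hMC : (fun i => (M : ℝ)⁻¹ * ((⌈c.1 i * M⌉₊ + r i : ℕ) : ℝ)) ∈ C := interior_subset
      (s := (Subtype.val ⁻¹' C : Set (Set.Ici (0 : Fin n → ℝ)))) hM
    simpa [mul_inv_cancel_left₀ hM0'] using hC _ hMC M (Nat.cast_nonneg M)
  obtain ⟨M, hM, hM'⟩ := ((hmem 0).and (eventually_all.2 fun i => hmem (Pi.single i 1))).exists
  exact ⟨fun i => ⌈c.1 i * M⌉₊, hM, hM'⟩

/-- A finite set of rational linear maps which compute all solutions of `φ` in `ℝ`, each of them on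
a natural point and all of its upper neighbours. -/
structure EFDSystem.IsPieceSet (φ : EFDSystem HoopLang) (D : Set (Fin φ.m → Fin φ.n → ℚ)) :
    Prop where
  finite : D.Finite
  exists_mem : ∀ x : Fin φ.n → ℝ, 0 ≤ x → ∃ d ∈ D, x ∈ φ.solSet d
  exists_nat : ∀ d ∈ D, ∃ q : Fin φ.n → ℕ, (fun i => (q i : ℝ)) ∈ φ.solSet d ∧
    ∀ i, (fun i' => ((q + Pi.single i 1 : Fin φ.n → ℕ) i' : ℝ)) ∈ φ.solSet d

theorem EFDSystem.UniqueOnChains.exists_isPieceSet {φ : EFDSystem HoopLang} (hφ : φ.UniqueOnChains)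
    (hnat : ∀ q : Fin φ.n → ℕ, ∃ z : Fin φ.m → ℝ, φ.Sol (Sum.elim (fun i => (q i : ℝ)) z)) :
    ∃ D, φ.IsPieceSet D := by
  obtain ⟨D, hD, hcover⟩ := hφ.exists_finite_ratLin
  have hnat' : ∀ q : Fin φ.n → ℕ, ∃ d ∈ D, (fun i => (q i : ℝ)) ∈ φ.solSet d := fun q => by
    obtain ⟨z, hz⟩ := hnat q
    obtain ⟨d, hd, rfl⟩ := hcover _ _ hz
    exact ⟨d, hd, hz⟩
  have : CompleteSpace (Set.Ici (0 : Fin φ.n → ℝ)) := isClosed_Ici.completeSpace_coe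
  let C : (Fin φ.m → Fin φ.n → ℚ) → Set (Set.Ici (0 : Fin φ.n → ℝ)) :=
    fun d => Subtype.val ⁻¹' φ.solSet d
  refine ⟨{d ∈ D | (interior (C d)).Nonempty}, hD.subset fun _ h => h.1, fun x hx => ?_,
    fun d hd => exists_nat_mem_of_interior_nonempty (fun x hx c hc => mul_mem_solSet hx hc) hd.2⟩
  obtain ⟨d, hd, hint, hmem⟩ := exists_mem_interior_nonempty_of_cover hD (C := C)
    (fun d => (φ.isClosed_solSet d).preimage continuous_subtype_val)
    (fun x => exists_mem_solSet hD hnat' x.2) ⟨x, hx⟩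
  exact ⟨d, ⟨hd, hint⟩, hmem⟩

/-- A subgroup of `ℚ` which contains `1` and has a common denominator is generated by the inverse
of a positive integer. -/
theorem AddSubgroup.exists_inv_natCast_mem {A : AddSubgroup ℚ} (hA : 1 ∈ A) {K : ℕ} (hK : 0 < K)
    (hden : ∀ a ∈ A, ∃ t : ℤ, (K : ℚ) * a = t) :
    ∃ k : ℕ, 0 < k ∧ (k : ℚ)⁻¹ ∈ A ∧ ∀ a ∈ A, ∃ t : ℤ, (k : ℚ) * a = t := by
  have hK0 : (K : ℚ) ≠ 0 := by positivity
  let f : ℤ →+ ℚ := (AddMonoidHom.mulRight (K : ℚ)⁻¹).comp (Int.castAddHom ℚ)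
  have hf : ∀ t, f t = t * (K : ℚ)⁻¹ := fun t => rfl
  obtain ⟨b, hb⟩ := Int.subgroup_cyclic (A.comap f)
  have hmem : ∀ t, f t ∈ A ↔ ∃ s : ℤ, s * b = t := fun t => by
    rw [← AddSubgroup.mem_comap, hb, AddSubgroup.mem_closure_singleton]
    simp
  obtain ⟨s, hs⟩ := (hmem K).1 (by simpa [hf, hK0] using hA)
  have hsb : (s : ℚ) * b = K := by exact_mod_cast hs
  have hs0 : (s : ℚ) ≠ 0 := fun h => hK0 (by rw [← hsb, h, zero_mul])
  have hinv : (s : ℚ)⁻¹ ∈ A := by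
    have hb0 : (b : ℚ) ≠ 0 := fun h => hK0 (by rw [← hsb, h, mul_zero])
    have h := (hmem b).2 ⟨1, one_mul b⟩
    rwa [hf, ← hsb, mul_inv, mul_comm, mul_assoc, inv_mul_cancel₀ hb0, mul_one] at h
  have habs : (s.natAbs : ℚ) = s ∨ (s.natAbs : ℚ) = -s := by
    rw [Nat.cast_natAbs, Int.cast_abs]
    exact abs_choice _
  have hdiv : ∀ a ∈ A, ∃ t : ℤ, (s : ℚ) * a = t := fun a ha => by
    obtain ⟨t, ht⟩ := hden a ha
    obtain ⟨u, hu⟩ := (hmem t).1 (by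
      rwa [hf, ← ht, mul_comm, inv_mul_cancel_left₀ hK0])
    refine ⟨u, mul_left_cancel₀ hK0 ?_⟩
    have hu' : (u : ℚ) * b = t := by exact_mod_cast hu
    rw [mul_left_comm, ht, ← hu', ← hsb]
    ring
  refine ⟨s.natAbs, Int.natAbs_pos.2 fun h => hs0 (by simp [h]), ?_, fun a ha => ?_⟩
  · rcases habs with h | h <;> rw [h]
    · exact hinv
    · rw [inv_neg]; exact A.neg_mem hinv
  · obtain ⟨t, ht⟩ := hdiv a ha
    rcases habs with h | h <;> rw [h]
    · exact ⟨t, ht⟩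
    · exact ⟨-t, by rw [neg_mul, ht, Int.cast_neg]⟩

/-- The group generated by `1` and the coordinates of the solutions of `φ` in `ℝ` at the natural
points. -/
def EFDSystem.valueGroup (φ : EFDSystem HoopLang) (D : Set (Fin φ.m → Fin φ.n → ℚ)) :
    AddSubgroup ℚ :=
  AddSubgroup.closure ({1} ∪ {s | ∃ d ∈ D, ∃ q : Fin φ.n → ℕ, (fun i => (q i : ℝ)) ∈ φ.solSet d ∧
    ∃ j, s = ∑ i, d j i * q i})

theorem exists_common_denominator_of_finite {n m : ℕ} {D : Set (Fin m → Fin n → ℚ)}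
    (hD : D.Finite) : ∃ K : ℕ, 0 < K ∧ ∀ d ∈ D, ∀ j i, ∃ t : ℤ, (K : ℚ) * d j i = t := by
  have := hD.to_subtype
  obtain ⟨K, hK, w, hw⟩ := exists_common_denominator
    fun p : D × Fin m × Fin n => p.1.1 p.2.1 p.2.2
  exact ⟨K, hK, fun d hd j i => ⟨_, hw (⟨d, hd⟩, j, i)⟩⟩

theorem EFDSystem.IsPieceSet.exists_inv_mem_valueGroup {φ : EFDSystem HoopLang}
    {D : Set (Fin φ.m → Fin φ.n → ℚ)} (hD : φ.IsPieceSet D) :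
    ∃ k : ℕ, 0 < k ∧ (k : ℚ)⁻¹ ∈ φ.valueGroup D ∧
      ∀ d ∈ D, ∃ w : Fin φ.m → Fin φ.n → ℤ, ∀ j i, (k : ℚ) * d j i = w j i := by
  obtain ⟨K, hK, hden⟩ := exists_common_denominator_of_finite hD.finite
  obtain ⟨k, hk, hinv, hint⟩ := AddSubgroup.exists_inv_natCast_mem (A := φ.valueGroup D)
    (AddSubgroup.subset_closure (Or.inl rfl)) hK (fun a ha => by
      induction ha using AddSubgroup.closure_induction with
      | mem a ha =>
        rcases ha with rfl | ⟨d, hd, q, -, j, rfl⟩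
        · exact ⟨K, by simp⟩
        · choose t ht using hden d hd j
          exact ⟨∑ i, t i * q i, by simp [Finset.mul_sum, ← mul_assoc, ht]⟩
      | zero => exact ⟨0, by simp⟩
      | add a b _ _ ha hb =>
        obtain ⟨s, hs⟩ := ha
        obtain ⟨t, ht⟩ := hb
        exact ⟨s + t, by rw [mul_add, hs, ht, Int.cast_add]⟩
      | neg a _ ha =>
        obtain ⟨s, hs⟩ := ha
        exact ⟨-s, by rw [mul_neg, hs, Int.cast_neg]⟩)
  refine ⟨k, hk, hinv, fun d hd => ?_⟩
  have hentry : ∀ j i, d j i ∈ φ.valueGroup D := fun j i => by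
    obtain ⟨q, hq, hq'⟩ := hD.exists_nat d hd
    have h := (φ.valueGroup D).sub_mem
      (AddSubgroup.subset_closure (Or.inr ⟨d, hd, q + Pi.single i 1, hq' i, j, rfl⟩))
      (AddSubgroup.subset_closure (Or.inr ⟨d, hd, q, hq, j, rfl⟩))
    simpa [mul_add, Finset.sum_add_distrib, Pi.single_apply] using h
  choose w hw using fun j i => hint _ (hentry j i)
  exact ⟨w, hw⟩

theorem sameSign_intCast {V : Type*} [Fintype V] (Λ : Set (V → ℤ)) (y : V → ℤ) :
    SameSign Λ y fun v => (y v : ℝ) := fun l _ => by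
  have h : intForm l (fun v => (y v : ℝ)) = ((intForm l y : ℤ) : ℝ) :=
    intForm_map (Int.castAddHom ℝ) l y
  rw [h, Int.cast_pos, Int.cast_lt_zero]
  exact ⟨Iff.rfl, Iff.rfl⟩

theorem EFDSystem.Sol.of_intCast {φ : EFDSystem HoopLang} {y : Fin φ.n ⊕ Fin φ.m → ℤ}
    (h : φ.Sol fun v => (y v : ℝ)) : φ.Sol y := by
  obtain ⟨Λ, -, hsol⟩ := φ.exists_forms_sol
  exact hsol ℝ ℤ _ _ (sameSign_intCast Λ y).symm h

theorem map_nonneg_of_map_sup {G H : Type*} [Lattice G] [AddCommGroup G] [Lattice H]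
    [AddCommGroup H] {π : G →+ H}
    (hπ : ∀ a b, π (a ⊔ b) = π a ⊔ π b) {a : G} (ha : 0 ≤ a) : 0 ≤ π a := by
  rw [← map_zero π, ← sup_eq_left, ← hπ, sup_eq_left.2 ha]

section LatticeGroup

variable {G : Type} [Lattice G] [AddCommGroup G] [AddLeftMono G]

theorem nonneg_of_forall_chain_hom {a : G}
    (h : ∀ (H : Type) [AddCommGroup H] [LinearOrder H] [IsOrderedAddMonoid H] (π : G →+ H),
      (∀ a b, π (a ⊔ b) = π a ⊔ π b) → 0 ≤ π a) : 0 ≤ a := by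
  rw [← sup_eq_left]
  refine eq_of_forall_chain_hom fun H _ _ _ π hπ => ?_
  rw [hπ, map_zero, sup_eq_left]
  exact h H π hπ

theorem nonneg_of_nsmul_nonneg_of_pos {k : ℕ} (hk : 0 < k) {a : G} (h : 0 ≤ k • a) : 0 ≤ a :=
  nonneg_of_forall_chain_hom fun H _ _ _ π hπ => by
    have := map_nonneg_of_map_sup hπ h
    rw [map_nsmul] at this
    exact (nsmul_nonneg_iff hk.ne').1 this

theorem nsmul_right_injective_of_pos {k : ℕ} (hk : 0 < k) :
    Function.Injective fun a : G => k • a := fun a b h => by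
  rw [← sub_eq_zero]
  refine zsmul_eq_zero_of_chain (c := k) (by exact_mod_cast hk.ne') ?_
  rw [natCast_zsmul, nsmul_sub, sub_eq_zero]
  exact h

theorem EFDSystem.Sol.nsmul {φ : EFDSystem HoopLang} {y : Fin φ.n ⊕ Fin φ.m → G} (h : φ.Sol y)
    (k : ℕ) : φ.Sol fun v => k • y v :=
  EFDSystem.sol_of_forall_chain_hom fun H _ _ _ π hπ => by
    simpa using (h.map π hπ).map_of_monotone (nsmulAddMonoidHom k)
      fun _ _ hab => nsmul_le_nsmul_right hab k

/-- The rational numbers `c` for which `c • a` makes sense in the divisible hull of `G` and belongs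
to `G`. -/
def rationalMultiples (a : G) : AddSubgroup ℚ where
  carrier := {c | ∃ (g : G) (N : ℕ) (p : ℤ), 0 < N ∧ (N : ℚ) * c = p ∧ N • g = p • a}
  zero_mem' := ⟨0, 1, 0, by simp⟩
  add_mem' := by
    rintro c c' ⟨g, N, p, hN, hc, hg⟩ ⟨g', N', p', hN', hc', hg'⟩
    refine ⟨g + g', N * N', N' * p + N * p', Nat.mul_pos hN hN', ?_, ?_⟩
    · push_cast
      rw [← hc, ← hc']
      ring
    · rw [nsmul_add, mul_nsmul, mul_nsmul', hg, hg', add_smul, mul_smul, mul_smul, natCast_zsmul,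
        natCast_zsmul]
  neg_mem' := by
    rintro c ⟨g, N, p, hN, hc, hg⟩
    exact ⟨-g, N, -p, hN, by rw [mul_neg, hc, Int.cast_neg], by rw [smul_neg, hg, neg_smul]⟩

theorem exists_nsmul_eq_of_inv_mem_rationalMultiples {a : G} {k : ℕ} (hk : 0 < k)
    (h : (k : ℚ)⁻¹ ∈ rationalMultiples a) : ∃ g : G, k • g = a := by
  obtain ⟨g, N, p, hN, hc, hg⟩ := h
  have hk0 : (k : ℚ) ≠ 0 := by positivity
  have hNp : (N : ℤ) = p * k := by
    have : (N : ℚ) = p * k := by rw [← hc, inv_mul_cancel_right₀ hk0]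
    exact_mod_cast this
  have hp : p ≠ 0 := by rintro rfl; simp at hNp; omega
  refine ⟨g, sub_eq_zero.1 (zsmul_eq_zero_of_chain hp ?_)⟩
  rw [smul_sub, ← hg, ← natCast_zsmul g k, ← mul_smul, ← hNp, natCast_zsmul, sub_self]

theorem EFDSystem.IsPieceSet.valueGroup_le_rationalMultiples {φ : EFDSystem HoopLang}
    {D : Set (Fin φ.m → Fin φ.n → ℚ)} (hD : φ.IsPieceSet D) (hφ : φ.UniqueOnChains)
    (hG : φ.Satisfies {x : G // 0 ≤ x}) {a : G} (ha : 0 ≤ a) :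
    φ.valueGroup D ≤ rationalMultiples a := by
  obtain ⟨K, hK, hden⟩ := exists_common_denominator_of_finite hD.finite
  refine (AddSubgroup.closure_le _).2 ?_
  rintro _ (rfl | ⟨d, hd, q, hq, j, rfl⟩)
  · exact ⟨a, 1, 1, by simp⟩
  choose t ht using hden d hd
  obtain ⟨z, hz, -⟩ := (φ.satisfies_posCone_iff G).1 hG (fun i => q i • a)
    fun i => nsmul_nonneg ha _
  let p : Fin φ.m → ℤ := fun j => ∑ i, t j i * q i
  have hp : ∀ j, (K : ℚ) * ∑ i, d j i * q i = p j := fun j => by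
    simp [p, Finset.mul_sum, ← mul_assoc, ht]
  have hint : φ.Sol (Sum.elim (fun i => (K * q i : ℤ)) p) := by
    refine EFDSystem.Sol.of_intCast ?_
    convert EFDSystem.Sol.mul_left hq (Nat.cast_nonneg K) using 1
    ext v
    cases v with
    | inl i => simp
    | inr j => simpa [ratLin] using (congrArg (fun c : ℚ => (c : ℝ)) (hp j)).symm
  have hsol := hint.map_of_monotone _ (monotone_zmultiplesHom ha)
  have heq := hφ.unique (x := fun i => K • q i • a) (z := fun j => K • z j) (w := fun j => p j • a)
    (by convert hz.nsmul K using 1; ext v; cases v <;> rfl)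
    (by
      convert hsol using 1
      ext v
      cases v with
      | inl i => simp [mul_smul]
      | inr j => rfl)
  exact ⟨z j, K, p j, hK, hp j, congrFun heq j⟩

end LatticeGroup

/-- If a function on `[0, 1]` is pieced together from finitely many affine functions on closed sets,
then one of these affine functions lies above it at `0` and below it at `1`. -/
theorem exists_affine_above_below {ι : Type*} {D : Set ι} (hD : D.Finite) {u v : ι → ℝ}
    {C : ι → Set ℝ} (hC : ∀ d, IsClosed (C d))
    (hcover : ∀ t ∈ Set.Icc (0 : ℝ) 1, ∃ d ∈ D, t ∈ C d) {f : ℝ → ℝ}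
    (hf : ∀ d, ∀ t ∈ C d, f t = u d + t * v d) : ∃ d ∈ D, f 0 ≤ u d ∧ u d + v d ≤ f 1 := by
  by_contra! hcon
  let Z : Set ℝ := ⋃ ρ ∈ {ρ ∈ D | f 0 ≤ u ρ}, ⋃ d ∈ D,
    Set.Icc 0 1 ∩ C d ∩ {t | u ρ + t * v ρ ≤ u d + t * v d}
  have hmemZ : ∀ t, t ∈ Z ↔ t ∈ Set.Icc (0 : ℝ) 1 ∧ ∃ ρ ∈ D, f 0 ≤ u ρ ∧ u ρ + t * v ρ ≤ f t := by
    intro t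
    simp only [Z, Set.mem_iUnion, exists_prop]
    constructor
    · rintro ⟨ρ, ⟨hρ, hρ0⟩, d, hd, ⟨ht, htd⟩, hle⟩
      exact ⟨ht, ρ, hρ, hρ0, (hf d t htd).symm ▸ hle⟩
    · rintro ⟨ht, ρ, hρ, hρ0, hle⟩
      obtain ⟨d, hd, htd⟩ := hcover t ht
      exact ⟨ρ, ⟨hρ, hρ0⟩, d, hd, ⟨ht, htd⟩, show _ ≤ _ from hf d t htd ▸ hle⟩
  have hZclosed : IsClosed Z := (hD.subset fun _ h => h.1).isClosed_biUnion fun ρ _ =>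
    hD.isClosed_biUnion fun d _ => (isClosed_Icc.inter (hC d)).inter
      (isClosed_le (by fun_prop) (by fun_prop))
  have hZcompact : IsCompact Z :=
    isCompact_Icc.of_isClosed_subset hZclosed fun t ht => ((hmemZ t).1 ht).1
  have h0 : (0 : ℝ) ∈ Z := by
    obtain ⟨d, hd, h0d⟩ := hcover 0 ⟨le_rfl, zero_le_one⟩
    have := hf d 0 h0d
    rw [zero_mul, add_zero] at this
    exact (hmemZ 0).2 ⟨⟨le_rfl, zero_le_one⟩, d, hd, this.le, by rw [zero_mul, add_zero, this]⟩
  obtain ⟨s, hsZ, hsmax⟩ := hZcompact.exists_isGreatest ⟨0, h0⟩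
  obtain ⟨⟨hs0, hs1⟩, ρ, hρ, hρ0, hρs⟩ := (hmemZ s).1 hsZ
  have hslt : s < 1 := lt_of_le_of_ne hs1 fun h => by
    subst h
    have := hcon ρ hρ hρ0
    linarith
  have hcov : Set.Ioc s 1 ⊆ ⋃ τ ∈ {τ ∈ D | u τ < f 0}, C τ ∩ Set.Ioc s 1 := fun t ht => by
    have ht' : t ∈ Set.Icc (0 : ℝ) 1 := ⟨hs0.trans ht.1.le, ht.2⟩
    obtain ⟨d, hd, htd⟩ := hcover t ht'
    refine Set.mem_biUnion ⟨hd, lt_of_not_ge fun h => ?_⟩ ⟨htd, ht⟩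
    exact (hsmax ((hmemZ t).2 ⟨ht', d, hd, h, (hf d t htd).ge⟩)).not_gt ht.1
  have hscl : s ∈ closure (⋃ τ ∈ {τ ∈ D | u τ < f 0}, C τ ∩ Set.Ioc s 1) :=
    closure_mono hcov (by rw [closure_Ioc hslt.ne]; exact ⟨le_rfl, hs1⟩)
  rw [(hD.subset fun _ h => h.1).closure_biUnion] at hscl
  simp only [Set.mem_iUnion, exists_prop] at hscl
  obtain ⟨τ, ⟨-, hτ0⟩, hsτ⟩ := hscl
  obtain ⟨t, htτ, ht⟩ := closure_nonempty_iff.1 ⟨s, hsτ⟩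
  have hfs := hf τ s ((hC τ).closure_subset_iff.2 Set.inter_subset_left hsτ)
  have hft : f t < u ρ + t * v ρ := lt_of_not_ge fun h =>
    (hsmax ((hmemZ t).2 ⟨⟨hs0.trans ht.1.le, ht.2⟩, ρ, hρ, hρ0, h⟩)).not_gt ht.1
  rw [hf τ t htτ] at hft
  rw [hfs] at hρs
  have hslope : v ρ < v τ := by
    by_contra! h
    nlinarith [mul_le_mul_of_nonneg_left h hs0]
  nlinarith [mul_lt_mul_of_pos_right ht.1 (sub_pos.2 hslope)]

theorem EFDSystem.IsPieceSet.exists_above_below {φ : EFDSystem HoopLang}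
    {D : Set (Fin φ.m → Fin φ.n → ℚ)} (hD : φ.IsPieceSet D) (hφ : φ.UniqueOnChains)
    {p q : Fin φ.n → ℝ} {z w : Fin φ.m → ℝ} (hz : φ.Sol (Sum.elim p z))
    (hw : φ.Sol (Sum.elim q w)) (j : Fin φ.m) :
    ∃ d ∈ D, z j ≤ ratLin d p j ∧ ratLin d q j ≤ w j := by
  have hp : 0 ≤ p := fun i => hz.1 (Sum.inl i)
  have hq : 0 ≤ q := fun i => hw.1 (Sum.inl i)
  let x : ℝ → Fin φ.n → ℝ := fun t => (1 - t) • p + t • q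
  have hx : Continuous x := by fun_prop
  let f : ℝ → ℝ := fun t => Classical.epsilon (fun z => φ.Sol (Sum.elim (x t) z)) j
  have hf : ∀ t z, φ.Sol (Sum.elim (x t) z) → f t = z j := fun t z h =>
    congrFun (hφ ℝ _ _ _ (Classical.epsilon_spec (p := fun z => φ.Sol (Sum.elim (x t) z)) ⟨z, h⟩) h) j
  obtain ⟨d, hd, h0, h1⟩ := exists_affine_above_below hD.finite (f := f)
    (u := fun d => ratLin d p j) (v := fun d => ratLin d q j - ratLin d p j)
    (C := fun d => x ⁻¹' φ.solSet d) (fun d => (φ.isClosed_solSet d).preimage hx)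
    (fun t ht => hD.exists_mem _ (add_nonneg (smul_nonneg (sub_nonneg.2 ht.2) hp)
      (smul_nonneg ht.1 hq)))
    (fun d t ht => by
      rw [hf t _ ht]
      simp only [ratLin, x, Pi.add_apply, Pi.smul_apply, smul_eq_mul, ← Finset.sum_sub_distrib,
        Finset.mul_sum, ← Finset.sum_add_distrib]
      exact Finset.sum_congr rfl fun _ _ => by ring)
  rw [hf 0 z (by simpa [x] using hz)] at h0
  rw [add_sub_cancel, hf 1 w (by simpa [x] using hw)] at h1
  exact ⟨d, hd, h0, h1⟩

theorem SameSign.trans {V G H K : Type*} [Fintype V] [AddCommGroup G] [LT G] [AddCommGroup H] [LT H]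
    [AddCommGroup K] [LT K] {Λ : Set (V → ℤ)} {x : V → G} {y : V → H} {z : V → K}
    (h : SameSign Λ x y) (h' : SameSign Λ y z) : SameSign Λ x z :=
  fun l hl => ⟨(h l hl).1.trans (h' l hl).1, (h l hl).2.trans (h' l hl).2⟩

theorem map_inf_of_map_sup {G H : Type*} [Lattice G] [AddCommGroup G] [AddLeftMono G] [Lattice H]
    [AddCommGroup H] [AddLeftMono H] {π : G →+ H} (hπ : ∀ a b, π (a ⊔ b) = π a ⊔ π b) (a b : G) :
    π (a ⊓ b) = π a ⊓ π b := by
  rw [← neg_inj, ← map_neg, neg_inf, neg_inf, hπ, map_neg, map_neg]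

/-- A finite supremum of finite infima, described by its images in chains. -/
theorem exists_sup_inf {G ι : Type*} [Lattice G] [AddCommGroup G] [AddLeftMono G]
    {𝒮 : Finset (Finset ι)} (h𝒮 : 𝒮.Nonempty) (hne : ∀ S ∈ 𝒮, S.Nonempty) (g : ι → G) :
    ∃ t : G, ∀ (H : Type) [AddCommGroup H] [LinearOrder H] [IsOrderedAddMonoid H] (π : G →+ H),
      (∀ a b, π (a ⊔ b) = π a ⊔ π b) →
      (∀ S ∈ 𝒮, ∃ d ∈ S, π (g d) ≤ π t) ∧ ∃ S ∈ 𝒮, ∀ d ∈ S, π t ≤ π (g d) := by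
  classical
  let s : Finset ι → G := fun S => if h : S.Nonempty then S.inf' h g else 0
  refine ⟨𝒮.sup' h𝒮 s, fun H _ _ _ π hπ => ?_⟩
  have hs : ∀ S (h : S.Nonempty), π (s S) = S.inf' h (π ∘ g) := fun S h => by
    simp only [s, dif_pos h]
    exact Finset.apply_inf'_eq_inf'_comp h π (map_inf_of_map_sup hπ)
  rw [Finset.apply_sup'_eq_sup'_comp h𝒮 π hπ]
  constructor
  · intro S hS
    obtain ⟨d, hd, hSd⟩ := Finset.exists_mem_eq_inf' (hne S hS) (π ∘ g)
    refine ⟨d, hd, ?_⟩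
    have : π (g d) = (π ∘ s) S := by rw [Function.comp_apply, hs S (hne S hS), hSd]; rfl
    rw [this]
    exact Finset.le_sup' _ hS
  · obtain ⟨S, hS, heq⟩ := Finset.exists_mem_eq_sup' h𝒮 (π ∘ s)
    refine ⟨S, hS, fun d hd => ?_⟩
    rw [heq, Function.comp_apply, hs S (hne S hS)]
    exact Finset.inf'_le (π ∘ g) hd

theorem intForm_eq_mul_ratLin {n m k : ℕ} {d : Fin m → Fin n → ℚ} {w : Fin m → Fin n → ℤ}
    (hw : ∀ j i, (k : ℚ) * d j i = w j i) (j : Fin m) (x : Fin n → ℝ) :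
    intForm (w j) x = k * ratLin d x j := by
  simp only [intForm, ratLin, Finset.mul_sum, zsmul_eq_mul]
  refine Finset.sum_congr rfl fun i _ => ?_
  rw [← mul_assoc, ← Rat.cast_intCast, ← hw j i]
  push_cast
  rfl

/-- If every element of `G` is divisible by `k` and `k` clears the denominators of the pieces, then
`φ` is solvable in `G`: the solution is the lattice polynomial provided by the pieces. -/
theorem EFDSystem.IsPieceSet.exists_sol {φ : EFDSystem HoopLang}
    {D : Set (Fin φ.m → Fin φ.n → ℚ)} (hD : φ.IsPieceSet D) (hφ : φ.UniqueOnChains) {k : ℕ}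
    (hk : 0 < k) (hden : ∀ d ∈ D, ∃ w : Fin φ.m → Fin φ.n → ℤ, ∀ j i, (k : ℚ) * d j i = w j i)
    {G : Type} [Lattice G] [AddCommGroup G] [AddLeftMono G] (hG : ∀ t : G, ∃ z, k • z = t)
    {x : Fin φ.n → G} (hx : ∀ i, 0 ≤ x i) : ∃ z, φ.Sol (Sum.elim x z) := by
  classical
  have hk' : (0 : ℝ) < k := by exact_mod_cast hk
  choose! W hW using hden
  let above : Fin φ.m → (Fin φ.n → ℝ) → (Fin φ.m → ℝ) → Finset (Fin φ.m → Fin φ.n → ℚ) :=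
    fun j p z => {d ∈ hD.finite.toFinset | z j ≤ ratLin d p j}
  have hmem : ∀ {j p z d}, d ∈ above j p z ↔ d ∈ D ∧ z j ≤ ratLin d p j := by simp [above]
  let 𝒮 : Fin φ.m → Finset (Finset (Fin φ.m → Fin φ.n → ℚ)) := fun j =>
    {S ∈ hD.finite.toFinset.powerset | ∃ p z, φ.Sol (Sum.elim p z) ∧ above j p z = S}
  have h𝒮mem : ∀ j p z, φ.Sol (Sum.elim p z) → above j p z ∈ 𝒮 j := fun j p z h =>
    Finset.mem_filter.2 ⟨Finset.mem_powerset.2 (Finset.filter_subset _ _), p, z, h, rfl⟩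
  have h𝒮 : ∀ j, (𝒮 j).Nonempty := fun j => by
    obtain ⟨d, -, hd⟩ := hD.exists_mem 0 le_rfl
    exact ⟨_, h𝒮mem j 0 _ hd⟩
  have hne : ∀ j, ∀ S ∈ 𝒮 j, S.Nonempty := fun j S hS => by
    obtain ⟨-, p, z, hz, rfl⟩ := Finset.mem_filter.1 hS
    obtain ⟨d, hd, hdz, -⟩ := hD.exists_above_below hφ hz hz j
    exact ⟨d, hmem.2 ⟨hd, hdz⟩⟩
  choose t ht using fun j => exists_sup_inf (h𝒮 j) (hne j) fun d => intForm (W d j) x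
  choose z hz using fun j => hG (t j)
  refine ⟨z, EFDSystem.sol_of_forall_chain_hom fun H _ _ _ π hπ => ?_⟩
  obtain ⟨Λ, hΛ, hsol⟩ := φ.exists_forms_sol
  let cmp : (Fin φ.m → Fin φ.n → ℚ) × Fin φ.m → Fin φ.n ⊕ Fin φ.m → ℤ := fun dj =>
    (k : ℤ) • Pi.single (Sum.inr dj.2) 1 - pushForm Sum.inl (W dj.1 dj.2)
  obtain ⟨y, hy⟩ := exists_int_sameSign (Λ := Λ ∪ cmp '' (D ×ˢ Set.univ) ∪
      Set.range fun i => Pi.single (Sum.inl i) 1)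
    ((hΛ.union ((hD.finite.prod Set.finite_univ).image _)).union (Set.finite_range _))
    fun v => π (Sum.elim x z v)
  replace hy := hy.trans (sameSign_intCast _ y)
  set p : Fin φ.n → ℝ := fun i => y (Sum.inl i)
  set ζ : Fin φ.m → ℝ := fun j => y (Sum.inr j)
  have hyR : (fun v => (y v : ℝ)) = Sum.elim p ζ := by ext v; cases v <;> rfl
  rw [hyR] at hy
  have hcmp : ∀ d ∈ D, ∀ j, SameSign {cmp (d, j)} (fun v => π (Sum.elim x z v)) (Sum.elim p ζ) :=
    fun d hd j => hy.mono (Set.singleton_subset_iff.2 (Or.inl (Or.inr ⟨_, ⟨hd, trivial⟩, rfl⟩)))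
  have hcmpH : ∀ d j, intForm (cmp (d, j)) (fun v => π (Sum.elim x z v)) =
      π (t j) - π (intForm (W d j) x) := fun d j => by
    rw [intForm_map, ← map_sub, intForm_sub, intForm_smul, intForm_single, intForm_pushForm,
      Sum.elim_inr, natCast_zsmul, hz, Sum.elim_comp_inl]
  have hcmpR : ∀ d ∈ D, ∀ j, intForm (cmp (d, j)) (Sum.elim p ζ) =
      k * (ζ j - ratLin d p j) := fun d hd j => by
    rw [intForm_sub, intForm_smul, intForm_single, intForm_pushForm, Sum.elim_inr, natCast_zsmul,
      Sum.elim_comp_inl, intForm_eq_mul_ratLin (hW d hd), nsmul_eq_mul, mul_sub]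
  have hp : 0 ≤ p := fun i => by
    have := hy.nonneg_iff (Or.inr ⟨i, rfl⟩)
    rw [intForm_single, intForm_single] at this
    exact this.1 (map_nonneg_of_map_sup hπ (hx i))
  obtain ⟨d₀, -, hd₀⟩ := hD.exists_mem p hp
  have hζ : ratLin d₀ p = ζ := by
    ext j
    obtain ⟨hge, S, hS, hle⟩ := ht j H π hπ
    refine le_antisymm ?_ ?_
    · obtain ⟨d, hd, hdt⟩ := hge _ (h𝒮mem j p _ hd₀)
      obtain ⟨hdD, hd₀d⟩ := hmem.1 hd
      have h := (hcmp d hdD j).nonneg_iff rfl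
      rw [hcmpH, hcmpR d hdD, sub_nonneg, mul_nonneg_iff_of_pos_left hk', sub_nonneg] at h
      exact hd₀d.trans (h.1 hdt)
    · obtain ⟨-, p', z', hz', rfl⟩ := Finset.mem_filter.1 hS
      obtain ⟨d, hdD, hdz', hdp⟩ := hD.exists_above_below hφ hz' hd₀ j
      have h := (hcmp d hdD j).nonpos_iff rfl
      rw [hcmpH, hcmpR d hdD, sub_nonpos, ← not_lt (a := (0 : ℝ)), mul_pos_iff_of_pos_left hk', not_lt,
        sub_nonpos] at h
      exact (h.1 (hle d (hmem.2 ⟨hdD, hdz'⟩))).trans hdp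
  refine hsol ℝ H _ _ (hy.mono (Set.subset_union_left.trans Set.subset_union_left)).symm ?_
  rw [← hζ]
  exact hd₀

theorem exists_nsmul_eq_of_posCone {G : Type*} [Lattice G] [AddCommGroup G] [AddLeftMono G] {k : ℕ}
    (h : ∀ x : {x : G // 0 ≤ x}, ∃ z : {x : G // 0 ≤ x}, k • (z : G) = (x : G)) (t : G) :
    ∃ z, k • z = t := by
  obtain ⟨u, hu⟩ := h ⟨t⁺, posPart_nonneg t⟩
  obtain ⟨v, hv⟩ := h ⟨t⁻, negPart_nonneg t⟩
  exact ⟨u - v, by rw [nsmul_sub, hu, hv, posPart_sub_negPart]⟩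

/-- Every EFD-sentence in the hoop language with a nontrivial cancellative-hoop model
(i.e. satisfied by the positive cone of some nontrivial abelian ℓ-group) is equivalent,
over all cancellative hoops, to `δ_k : ∀ x ∃! z, k z = x` for some positive integer `k`. -/
theorem hoop_efd_equiv_delta_k (φ : EFDSystem HoopLang)
    (A : Type) [Lattice A] [AddCommGroup A] [CovariantClass A A (· + ·) (· ≤ ·)]
    [Nontrivial A] (hA : φ.Satisfies {x : A // 0 ≤ x}) :
    ∃ k : ℕ, 0 < k ∧
      ∀ (G : Type) [Lattice G] [AddCommGroup G] [CovariantClass G G (· + ·) (· ≤ ·)],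
        φ.Satisfies {x : G // 0 ≤ x} ↔
          ∀ x : {x : G // 0 ≤ x}, ∃! z : {x : G // 0 ≤ x}, k • (z : G) = (x : G) := by
  obtain ⟨D, hD⟩ := (EFDSystem.uniqueOnChains_of_satisfies hA).exists_isPieceSet
    (EFDSystem.exists_sol_natCast_of_satisfies hA)
  have hφ := EFDSystem.uniqueOnChains_of_satisfies hA
  obtain ⟨k, hk, hinv, hden⟩ := hD.exists_inv_mem_valueGroup
  refine ⟨k, hk, fun G _ _ _ => ⟨fun hG x => ?_, fun hG => ?_⟩⟩
  · obtain ⟨g, hg⟩ := exists_nsmul_eq_of_inv_mem_rationalMultiples hk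
      (hD.valueGroup_le_rationalMultiples hφ hG x.2 hinv)
    exact ⟨⟨g, nonneg_of_nsmul_nonneg_of_pos hk (hg.symm ▸ x.2)⟩, hg, fun w hw =>
      Subtype.ext (nsmul_right_injective_of_pos hk (hw.trans hg.symm))⟩
  · refine (φ.satisfies_posCone_iff G).2 fun x hx => ?_
    obtain ⟨z, hz⟩ := hD.exists_sol hφ hk hden
      (exists_nsmul_eq_of_posCone fun x => (hG x).exists) hx
    exact ⟨z, hz, fun w hw => hφ.unique hw hz⟩
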